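/- arXiv:2210.14006 — 4 statements merged into one kernel-verified Lean document; each statement's English description precedes it below -/
import Mathlib

section
/- There exists a constant C > 0 such that for every fixed even integer q ≥ 2 and all sufficiently large n, there exist an integer N and an injective encoding map E : Z_q^{n−1} → Z_q^N such that (N − (n−1))·log₂ q ≤ 5·log₂ n + C·log₂ q·log₂ log₂ n, and the code C = {E(u) : u ∈ Z_q^{n−1}} is a two-deletion correcting code, i.e., for all distinct u, u' ∈ Z_q^{n−1}, D₂(E(u)) ∩ D₂(E(u')) = ∅. -/
/-- `Dset t x` : the set of subsequences of `x` obtained by deleting `t` symbols. -/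
def Dset {α : Type*} (t : ℕ) (x : List α) : Set (List α) :=
  {y | y.Sublist x ∧ y.length + t = x.length}

/-- A proper sublist is a sublist of the list with a single entry erased. -/
theorem List.Sublist.exists_eraseIdx {α : Type*} {y x : List α} (h : y.Sublist x)
    (hlt : y.length < x.length) : ∃ i < x.length, y.Sublist (x.eraseIdx i) := by
  induction h with
  | slnil => simp at hlt
  | cons a h _ => exact ⟨0, by simp, by simpa using h⟩
  | cons_cons a h ih =>
    obtain ⟨i, hi, hs⟩ := ih (by simpa using hlt)
    exact ⟨i + 1, by simpa using hi, by simpa using hs⟩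

theorem exists_eraseIdx_of_mem_Dset_two {α : Type*} {y x : List α} (h : y ∈ Dset 2 x) :
    ∃ i < x.length, ∃ j < x.length - 1, y = (x.eraseIdx i).eraseIdx j := by
  obtain ⟨hs, hl⟩ := h
  obtain ⟨i, hi, hs₁⟩ := hs.exists_eraseIdx (by omega)
  have hl₁ : (x.eraseIdx i).length = x.length - 1 := List.length_eraseIdx_of_lt hi
  obtain ⟨j, hj, hs₂⟩ := hs₁.exists_eraseIdx (by omega)
  have hl₂ := List.length_eraseIdx_of_lt hj
  exact ⟨i, hi, j, by omega, hs₂.eq_of_length (by omega)⟩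

/-- The list obtained from `x` by two erasures followed by two insertions. -/
def editTwo {α : Type*} (x : List α) (p : (ℕ × ℕ) × (ℕ × α) × (ℕ × α)) : List α :=
  (((x.eraseIdx p.1.1).eraseIdx p.1.2).insertIdx p.2.1.1 p.2.1.2).insertIdx p.2.2.1 p.2.2.2

theorem exists_editTwo_of_inter_nonempty {α : Type*} {x z : List α}
    (h : (Dset 2 x ∩ Dset 2 z).Nonempty) :
    ∃ i < x.length, ∃ j < x.length, ∃ k < x.length, ∃ l < x.length, ∃ a b : α,
      z = editTwo x ((i, j), (k, a), (l, b)) := by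
  obtain ⟨y, hx, hz⟩ := h
  have hlen : x.length = z.length := hx.2.symm.trans hz.2
  obtain ⟨i, hi, j, hj, hxy⟩ := exists_eraseIdx_of_mem_Dset_two hx
  obtain ⟨l, hl, k, hk, hzy⟩ := exists_eraseIdx_of_mem_Dset_two hz
  have hk' : k < (z.eraseIdx l).length := by rwa [List.length_eraseIdx_of_lt hl]
  refine ⟨i, hi, j, by omega, k, by omega, l, by omega, (z.eraseIdx l)[k], z[l], ?_⟩
  simp only [editTwo]
  rw [← hxy, hzy, List.insertIdx_eraseIdx_getElem hk', List.insertIdx_eraseIdx_getElem hl]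

open Classical in
/-- At most `N ^ 4 * q ^ 2` words of length `N` share a subsequence of length `N - 2` with a
given word of length `N`. -/
theorem card_inter_Dset_two_nonempty_le {q N : ℕ} (x : List.Vector (Fin q) N) :
    (Finset.univ.filter fun z : List.Vector (Fin q) N =>
      (Dset 2 x.val ∩ Dset 2 z.val).Nonempty).card ≤ N ^ 4 * q ^ 2 := by
  let R := Finset.range N
  let A : Finset (Fin q) := Finset.univ
  calc _ = ((Finset.univ.filter fun z : List.Vector (Fin q) N =>
          (Dset 2 x.val ∩ Dset 2 z.val).Nonempty).image Subtype.val).card :=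
        (Finset.card_image_of_injective _ Subtype.val_injective).symm
    _ ≤ (((R ×ˢ R) ×ˢ (R ×ˢ A) ×ˢ (R ×ˢ A)).image (editTwo x.val)).card := by
        refine Finset.card_le_card fun w hw => ?_
        obtain ⟨z, hz, rfl⟩ := Finset.mem_image.1 hw
        obtain ⟨i, hi, j, hj, k, hk, l, hl, a, b, hzx⟩ :=
          exists_editTwo_of_inter_nonempty (Finset.mem_filter.1 hz).2
        rw [x.2] at hi hj hk hl
        exact Finset.mem_image.2 ⟨((i, j), (k, a), (l, b)), by simp [R, A, *], hzx.symm⟩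
    _ ≤ ((R ×ˢ R) ×ˢ (R ×ˢ A) ×ˢ (R ×ˢ A)).card := Finset.card_image_le
    _ = N ^ 4 * q ^ 2 := by simp [R, A]; ring

/-- Gilbert–Varshamov bound: if a reflexive symmetric relation has all neighbourhoods of size at
most `d`, there is a set of pairwise unrelated points of density at least `1 / d`. -/
theorem exists_pairwise_not_card_le_mul {V : Type*} [Fintype V] (r : V → V → Prop)
    [DecidableRel r] (hrefl : ∀ v, r v v) (hsymm : ∀ v w, r v w → r w v) (d : ℕ)
    (hd : ∀ v, (Finset.univ.filter (r v)).card ≤ d) :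
    ∃ S : Finset V, (S : Set V).Pairwise (fun v w => ¬ r v w) ∧ Fintype.card V ≤ S.card * d := by
  classical
  obtain ⟨S, hS⟩ := Finset.exists_maximal
    (s := Finset.univ.filter fun S : Finset V => (S : Set V).Pairwise fun v w => ¬ r v w)
    ⟨∅, by simp⟩
  have hp : (S : Set V).Pairwise fun v w => ¬ r v w := by simpa using hS.prop
  refine ⟨S, hp, ?_⟩
  have hcover : Finset.univ ⊆ S.biUnion fun v => Finset.univ.filter (r v) := by
    intro w _
    by_contra hw
    have hnot : ∀ v ∈ S, ¬ r v w := by simpa using hw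
    have hins : ((insert w S : Finset V) : Set V).Pairwise fun v w => ¬ r v w := by
      rw [Finset.coe_insert]
      exact hp.insert fun v hv _ => ⟨fun h => hnot v hv (hsymm _ _ h), hnot v hv⟩
    have hw' : w ∈ S :=
      hS.le_of_ge (by simpa using hins) (Finset.subset_insert w S) (Finset.mem_insert_self w S)
    exact hnot w hw' (hrefl w)
  calc Fintype.card V ≤ _ := Finset.card_le_card hcover
    _ ≤ S.card * d := Finset.card_biUnion_le_card_mul _ _ _ fun v _ => hd v

theorem Dset_two_inter_self_nonempty {α : Type*} {x : List α} (h : 2 ≤ x.length) :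
    (Dset 2 x ∩ Dset 2 x).Nonempty :=
  ⟨x.drop 2, by simp [Dset, List.drop_sublist, h]⟩

/-- A two-deletion correcting code with `q ^ k` codewords of length `N` exists as soon as
`q ^ k * (N ^ 4 * q ^ 2) ≤ q ^ N`. -/
theorem exists_two_deletion_code {q k N : ℕ} (hq : 0 < q) (hN : 2 ≤ N)
    (h : q ^ k * (N ^ 4 * q ^ 2) ≤ q ^ N) :
    ∃ E : List.Vector (Fin q) k → List.Vector (Fin q) N, Function.Injective E ∧
      ∀ u u', u ≠ u' → Dset 2 (E u).val ∩ Dset 2 (E u').val = ∅ := by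
  classical
  obtain ⟨S, hS, hcard⟩ := exists_pairwise_not_card_le_mul
    (fun x z : List.Vector (Fin q) N => (Dset 2 x.val ∩ Dset 2 z.val).Nonempty)
    (fun x => Dset_two_inter_self_nonempty (hN.trans_eq x.2.symm))
    (fun x z h => by rwa [Set.inter_comm]) (N ^ 4 * q ^ 2)
    (fun x => card_inter_Dset_two_nonempty_le x)
  have hle : q ^ k ≤ S.card := by
    rw [card_vector, Fintype.card_fin] at hcard
    exact Nat.le_of_mul_le_mul_right (h.trans hcard) (by positivity)
  obtain ⟨f⟩ : Nonempty (List.Vector (Fin q) k ↪ S) :=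
    Function.Embedding.nonempty_of_card_le (by simpa [card_vector] using hle)
  have hf : Function.Injective fun u => (f u).val := Subtype.val_injective.comp f.injective
  exact ⟨fun u => (f u).val, hf, fun u u' huu' =>
    Set.not_nonempty_iff_eq_empty.1 (hS (f u).2 (f u').2 (hf.ne huu'))⟩

theorem exists_forall_pow_five_lt_two_pow : ∃ m : ℕ, ∀ n : ℕ, m ≤ n → n ^ 5 < 2 ^ n := by
  have h := (isLittleO_pow_const_const_pow_of_one_lt (R := ℝ) 5
    (one_lt_two : (1 : ℝ) < 2)).bound (show (0 : ℝ) < 1 / 2 by norm_num)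
  obtain ⟨m, hm⟩ := Filter.eventually_atTop.1 h
  refine ⟨m, fun n hn => ?_⟩
  have h₁ := hm n hn
  simp only [norm_pow, Real.norm_natCast, Real.norm_ofNat] at h₁
  have h₂ : (0 : ℝ) < 2 ^ n := by positivity
  exact_mod_cast (show (n : ℝ) ^ 5 < 2 ^ n by linarith)

theorem stmt_1 :
    ∃ C : ℝ, 0 < C ∧ ∀ q : ℕ, 2 ≤ q → Even q →
      ∃ n₀ : ℕ, ∀ n : ℕ, n₀ ≤ n →
        ∃ N : ℕ,
          ∃ E : {u : List (Fin q) // u.length = n - 1} → {v : List (Fin q) // v.length = N},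
            Function.Injective E ∧
            ((N : ℝ) - ((n : ℝ) - 1)) * Real.logb 2 q ≤
              5 * Real.logb 2 n + C * Real.logb 2 q * Real.logb 2 (Real.logb 2 n) ∧
            ∀ u u' : {u : List (Fin q) // u.length = n - 1}, u ≠ u' →
              Dset 2 (E u).val ∩ Dset 2 (E u').val = ∅ := by
  refine ⟨1, one_pos, fun q hq _ => ?_⟩
  obtain ⟨m, hm⟩ := exists_forall_pow_five_lt_two_pow
  refine ⟨max m (16 * q ^ 3 + 4), fun n hn => ?_⟩
  have hnm : n ^ 5 < 2 ^ n := hm n ((le_max_left _ _).trans hn)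
  have hnq : 16 * q ^ 3 + 4 ≤ n := (le_max_right _ _).trans hn
  have hn0 : n ^ 5 ≠ 0 := pow_ne_zero _ (by omega)
  let r := Nat.log q (n ^ 5)
  have hr₁ : q ^ r ≤ n ^ 5 := Nat.pow_log_le_self q hn0
  have hr₂ : n ^ 5 < q ^ (r + 1) := Nat.lt_pow_succ_log_self (by omega) _
  have hrn : r < n := (Nat.pow_lt_pow_iff_right (by norm_num : 1 < 2)).1
    (((Nat.pow_le_pow_left hq r).trans hr₁).trans_lt hnm)
  have hcount : (n - 1 + r) ^ 4 * q ^ 2 ≤ q ^ r := by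
    refine Nat.le_of_mul_le_mul_right (c := q) ?_ (by omega)
    calc (n - 1 + r) ^ 4 * q ^ 2 * q ≤ (2 * n) ^ 4 * q ^ 2 * q := by gcongr; omega
      _ = n ^ 4 * (16 * q ^ 3) := by ring
      _ ≤ n ^ 4 * n := by gcongr; omega
      _ = n ^ 5 := by ring
      _ ≤ q ^ r * q := by rw [← pow_succ]; exact hr₂.le
  obtain ⟨E, hE, hcode⟩ := exists_two_deletion_code (q := q) (k := n - 1) (N := n - 1 + r)
    (by omega) (by omega) (by rw [pow_add q]; gcongr)
  refine ⟨n - 1 + r, E, hE, ?_, hcode⟩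
  have hn4 : (4 : ℝ) ≤ n := by exact_mod_cast (by omega : 4 ≤ n)
  have hq2 : (2 : ℝ) ≤ q := by exact_mod_cast hq
  have hred : (r : ℝ) * Real.logb 2 q ≤ 5 * Real.logb 2 n := by
    have h := Real.logb_le_logb_of_le (b := 2) (by norm_num) (by positivity)
      (show (q : ℝ) ^ r ≤ (n : ℝ) ^ 5 by exact_mod_cast hr₁)
    simpa [Real.logb_pow] using h
  have hlogq : 0 ≤ Real.logb 2 q := Real.logb_nonneg (by norm_num) (by linarith)
  have hlogn : 1 ≤ Real.logb 2 n := by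
    rw [Real.le_logb_iff_rpow_le (by norm_num) (by linarith), Real.rpow_one]
    linarith
  have hloglog : 0 ≤ Real.logb 2 (Real.logb 2 n) := Real.logb_nonneg (by norm_num) hlogn
  have hcast : (((n - 1 + r : ℕ) : ℝ) - ((n : ℝ) - 1)) = r := by
    rw [Nat.cast_add, Nat.cast_sub (by omega : 1 ≤ n), Nat.cast_one]
    ring
  rw [hcast, one_mul]
  exact hred.trans (le_add_of_nonneg_right (mul_nonneg hlogq hloglog))
end

section
/- For every integer t ≥ 1 and every real ε > 0 there exist a constant γ (depending only on t and ε) and an integer n₀ such that for all n ≥ n₀ there exist a positive integer m with m ≤ log₂ n + (8+ε)·log₂ log₂ n + γ and a function f : {0,1}^n → {0,1}^m with the following property: for all (0^t1^t, t·2^{t+1}·⌈log₂ n⌉)-dense strings c, c' ∈ {0,1}^n, if f(c) = f(c') and B_{≤t}(c) ∩ B_{≤t}(c') ≠ ∅, then c = c'. (Consequently, any (0^t1^t, t·2^{t+1}·⌈log₂ n⌉)-dense c can be uniquely recovered from f(c) together with any element of B_{≤t}(c).) -/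
/-- `Bset t x` : strings obtained from `x` by deleting a burst of at most `t`
consecutive symbols. -/
def Bset {α : Type*} (t : ℕ) (x : List α) : Set (List α) :=
  {y | ∃ u v w : List α, x = u ++ v ++ w ∧ y = u ++ w ∧ v.length ≤ t}

/-- A binary string `c` is `(p, δ)`-dense if every substring of `c` of length `δ`
contains `p` as a substring. -/
def DenseStr (p : List Bool) (δ : ℕ) (c : List Bool) : Prop :=
  ∀ v : List Bool, v.IsInfix c → v.length = δ → p.IsInfix v

/-- The pattern `0^t 1^t`. -/
def pat (t : ℕ) : List Bool := List.replicate t false ++ List.replicate t true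

/-- The word `x` has the pattern `0^t 1^t` at position `q`. -/
def HasMarkerAt (t : ℕ) (x : ℕ → Option Bool) (q : ℕ) : Prop :=
  (∀ i < t, x (q + i) = some false) ∧ ∀ i < t, x (q + t + i) = some true

open scoped Classical in
/-- The sum of the weights `w q` over the marker positions `q` in `[lo, hi)`. -/
noncomputable def markerSum (t : ℕ) (x : ℕ → Option Bool) (w : ℕ → ℤ) (lo hi : ℕ) : ℤ :=
  ∑ q ∈ Finset.Ico lo hi, if HasMarkerAt t x q then w q else 0

lemma HasMarkerAt.add_two_mul_le {t : ℕ} {x : ℕ → Option Bool} {p q : ℕ}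
    (hp : HasMarkerAt t x p) (hq : HasMarkerAt t x q) (hpq : p < q) : p + 2 * t ≤ q := by
  by_contra! h
  rcases lt_or_ge q (p + t) with h1 | h1
  · have e1 := hp.2 0 (by omega)
    have e2 := hq.1 (p + t - q) (by omega)
    rw [show q + (p + t - q) = p + t + 0 by omega, e1] at e2
    simp at e2
  · have e1 := hq.1 0 (by omega)
    have e2 := hp.2 (q - (p + t)) (by omega)
    rw [show p + t + (q - (p + t)) = q + 0 by omega, e1] at e2
    simp at e2

lemma HasMarkerAt.congr_shift {t s q : ℕ} {x y : ℕ → Option Bool}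
    (h : ∀ i < 2 * t, x (q + s + i) = y (q + i)) :
    HasMarkerAt t x (q + s) ↔ HasMarkerAt t y q := by
  have h1 : ∀ i < t, x (q + s + i) = y (q + i) := fun i hi => h i (by omega)
  have h2 : ∀ i < t, x (q + s + t + i) = y (q + t + i) := fun i hi => by
    have := h (t + i) (by omega)
    simpa [add_assoc] using this
  unfold HasMarkerAt
  constructor
  · rintro ⟨u, v⟩
    exact ⟨fun i hi => (h1 i hi) ▸ u i hi, fun i hi => (h2 i hi) ▸ v i hi⟩
  · rintro ⟨u, v⟩
    exact ⟨fun i hi => (h1 i hi).symm ▸ u i hi, fun i hi => (h2 i hi).symm ▸ v i hi⟩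

lemma markerSum_split {t : ℕ} {x : ℕ → Option Bool} {w : ℕ → ℤ} {lo mid hi : ℕ}
    (h1 : lo ≤ mid) (h2 : mid ≤ hi) :
    markerSum t x w lo hi = markerSum t x w lo mid + markerSum t x w mid hi :=
  (Finset.sum_Ico_consecutive _ h1 h2).symm

lemma markerSum_shift {t s lo hi : ℕ} {x y : ℕ → Option Bool} {w : ℕ → ℤ}
    (h : ∀ q, lo ≤ q → q < hi → ∀ i < 2 * t, x (q + s + i) = y (q + i)) :
    markerSum t x w (lo + s) (hi + s) = markerSum t y (fun q => w (q + s)) lo hi := by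
  classical
  unfold markerSum
  rw [← Finset.sum_Ico_add']
  refine Finset.sum_congr rfl fun q hq => ?_
  rw [Finset.mem_Ico] at hq
  exact if_congr (HasMarkerAt.congr_shift (h q hq.1 hq.2)) rfl rfl

lemma markerSum_congr {t lo hi : ℕ} {x y : ℕ → Option Bool} {w : ℕ → ℤ}
    (h : ∀ q, lo ≤ q → q < hi → ∀ i < 2 * t, x (q + i) = y (q + i)) :
    markerSum t x w lo hi = markerSum t y w lo hi :=
  markerSum_shift (s := 0) h

open scoped Classical in
lemma markerSum_one_eq_card {t lo hi : ℕ} {x : ℕ → Option Bool} :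
    markerSum t x (fun _ => 1) lo hi =
      ((Finset.Ico lo hi).filter fun q => HasMarkerAt t x q).card := by
  simp [markerSum]

lemma markerSum_one_nonneg {t lo hi : ℕ} {x : ℕ → Option Bool} :
    0 ≤ markerSum t x (fun _ => 1) lo hi := by
  classical
  rw [markerSum_one_eq_card]; positivity

lemma markerSum_one_le {t lo hi k : ℕ} {x : ℕ → Option Bool} (h : hi ≤ lo + k) :
    markerSum t x (fun _ => 1) lo hi ≤ k := by
  classical
  rw [markerSum_one_eq_card]
  have := Finset.card_filter_le (Finset.Ico lo hi) (fun q => HasMarkerAt t x q)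
  rw [Nat.card_Ico] at this
  exact_mod_cast (by omega)

lemma abs_markerSum_sub_le {t lo hi k : ℕ} {x : ℕ → Option Bool} {p E : ℤ} (hE : 0 ≤ E)
    (h : hi ≤ lo + k) (hp : ∀ q : ℕ, lo ≤ q → q < hi → |(q : ℤ) - p| ≤ E) :
    |markerSum t x (fun q => q) lo hi - markerSum t x (fun _ => 1) lo hi * p| ≤ k * E := by
  unfold markerSum
  rw [Finset.sum_mul, ← Finset.sum_sub_distrib]
  refine (Finset.abs_sum_le_sum_abs _ _).trans ?_
  calc _ ≤ ∑ q ∈ Finset.Ico lo hi, E := by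
        refine Finset.sum_le_sum fun q hq => ?_
        rw [Finset.mem_Ico] at hq
        split_ifs
        · simpa using hp q hq.1 hq.2
        · simpa using hE
    _ ≤ k * E := by
        rw [Finset.sum_const, Nat.card_Ico, nsmul_eq_mul]
        have : ((hi - lo : ℕ) : ℤ) ≤ k := by exact_mod_cast (by omega)
        gcongr

lemma two_mul_markerSum_one_le {t lo l : ℕ} {x : ℕ → Option Bool} :
    2 * t * markerSum t x (fun _ => 1) lo (lo + l) ≤ l + 2 * t := by
  classical
  rw [markerSum_one_eq_card]
  set F := (Finset.Ico lo (lo + l)).filter fun q => HasMarkerAt t x q with hF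
  have hdisj : (F : Set ℕ).PairwiseDisjoint fun q => Finset.Ico q (q + 2 * t) := by
    intro p hp q hq hpq
    have hp' := (Finset.mem_filter.1 hp).2
    have hq' := (Finset.mem_filter.1 hq).2
    simp only [Function.onFun, Finset.disjoint_left, Finset.mem_Ico]
    intro r hr hr'
    rcases lt_or_gt_of_ne hpq with h | h
    · have := hp'.add_two_mul_le hq' h; omega
    · have := hq'.add_two_mul_le hp' h; omega
  have hsub : F.biUnion (fun q => Finset.Ico q (q + 2 * t)) ⊆ Finset.Ico lo (lo + l + 2 * t) := by
    intro r hr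
    simp only [Finset.mem_biUnion, hF, Finset.mem_filter, Finset.mem_Ico] at hr ⊢
    obtain ⟨q, ⟨h1, -⟩, h2⟩ := hr
    omega
  have := Finset.card_le_card hsub
  rw [Finset.card_biUnion hdisj] at this
  simp only [Nat.card_Ico, add_tsub_cancel_left, Finset.sum_const, smul_eq_mul] at this
  have h2 : 2 * t * F.card ≤ l + 2 * t := by
    rw [mul_comm]; omega
  exact_mod_cast h2

lemma lt_mul_markerSum_one_add_one {t lo L l δ : ℕ} {x : ℕ → Option Bool} (ht : 0 < t)
    (hδ : 0 < δ) (hL : L + 1 = l + 2 * t)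
    (hd : ∀ i, lo ≤ i → i + δ ≤ lo + L → ∃ q, i ≤ q ∧ q + 2 * t ≤ i + δ ∧ HasMarkerAt t x q) :
    (L : ℤ) < (markerSum t x (fun _ => 1) lo (lo + l) + 1) * δ := by
  classical
  rw [markerSum_one_eq_card]
  set F := (Finset.Ico lo (lo + l)).filter fun q => HasMarkerAt t x q with hF
  have key : ∀ j, j < L / δ → ∃ q ∈ F, (q - lo) / δ = j := by
    intro j hj
    have hj' : (j + 1) * δ ≤ L := (Nat.mul_le_mul_right δ hj).trans (Nat.div_mul_le_self L δ)
    rw [add_mul, one_mul] at hj'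
    obtain ⟨q, h1, h2, h3⟩ := hd (lo + j * δ) (by omega) (by omega)
    refine ⟨q, ?_, ?_⟩
    · simp only [hF, Finset.mem_filter, Finset.mem_Ico]
      exact ⟨⟨by omega, by omega⟩, h3⟩
    · rw [Nat.div_eq_iff hδ]
      rw [Nat.mul_comm j δ] at *
      constructor
      · omega
      · omega
  have : L / δ ≤ F.card := by
    have hs : Finset.range (L / δ) ⊆ F.image fun q => (q - lo) / δ := by
      intro j hj
      obtain ⟨q, h1, h2⟩ := key j (Finset.mem_range.1 hj)
      exact Finset.mem_image.2 ⟨q, h1, h2⟩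
    simpa using (Finset.card_le_card hs).trans Finset.card_image_le
  have h2 : L < (F.card + 1) * δ :=
    (Nat.lt_mul_of_div_lt (Nat.lt_succ_of_le this) hδ)
  exact_mod_cast h2

lemma burst_gap_le {t s a L n δ : ℕ} {x y : ℕ → Option Bool} (hs : 1 ≤ s) (hst : s ≤ t)
    (h1 : ∀ q < a, x q = y q) (h2 : ∀ q, a ≤ q → q < a + L → x (q + s) = y q)
    (h3 : ∀ q, a + L + s ≤ q → x q = y q) (hn : a + L + s ≤ n) (hδ : 0 < δ)
    (hd : ∀ i, a + s ≤ i → i + δ ≤ a + s + L →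
      ∃ q, i ≤ q ∧ q + 2 * t ≤ i + δ ∧ HasMarkerAt t x q)
    (hc : markerSum t x (fun _ => 1) 0 n ≡ markerSum t y (fun _ => 1) 0 n [ZMOD (11 * t : ℕ)])
    (hS : markerSum t x (fun q => q) 0 n ≡ markerSum t y (fun q => q) 0 n
      [ZMOD (100 * t ^ 2 * n : ℕ)]) :
    L + s ≤ 200 * t ^ 2 * δ := by
  by_contra! hcon
  have htt : t ≤ t ^ 2 := Nat.le_self_pow two_ne_zero t
  have htδ : t ^ 2 ≤ t ^ 2 * δ := Nat.le_mul_of_pos_right _ hδ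
  obtain ⟨l, hl⟩ : ∃ l, L + 1 = l + 2 * t := ⟨L + 1 - 2 * t, by lia⟩
  have splitx : ∀ w, markerSum t x w 0 n = markerSum t x w 0 (a - 2 * t) +
      markerSum t x w (a - 2 * t) (a + s) + markerSum t x w (a + s) (a + l + s) +
      markerSum t x w (a + l + s) (a + L + s) + markerSum t x w (a + L + s) n := by
    intro w
    rw [← markerSum_split (by omega) (by omega), ← markerSum_split (by omega) (by omega),
      ← markerSum_split (by omega) (by omega), ← markerSum_split (by omega) (by omega)]
  have splity : ∀ w, markerSum t y w 0 n = markerSum t y w 0 (a - 2 * t) +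
      markerSum t y w (a - 2 * t) a + markerSum t y w a (a + l) +
      markerSum t y w (a + l) (a + L + s) + markerSum t y w (a + L + s) n := by
    intro w
    rw [← markerSum_split (by omega) (by omega), ← markerSum_split (by omega) (by omega),
      ← markerSum_split (by omega) (by omega), ← markerSum_split (by omega) (by omega)]
  have left : ∀ w, markerSum t x w 0 (a - 2 * t) = markerSum t y w 0 (a - 2 * t) := fun w =>
    markerSum_congr fun q _ hq i hi => h1 _ (by omega)
  have right : ∀ w, markerSum t x w (a + L + s) n = markerSum t y w (a + L + s) n := fun w =>
    markerSum_congr fun q hq _ i hi => h3 _ (by omega)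
  have mid : ∀ w, markerSum t x w (a + s) (a + l + s) =
      markerSum t y (fun q => w (q + s)) a (a + l) := fun w =>
    markerSum_shift fun q hq hq' i hi => by
      rw [show q + s + i = q + i + s by omega]; exact h2 _ (by omega) (by omega)
  have mid' : markerSum t x (fun q => q) (a + s) (a + l + s) =
      markerSum t y (fun q => q) a (a + l) + s * markerSum t y (fun _ => 1) a (a + l) := by
    rw [mid]
    unfold markerSum
    rw [Finset.mul_sum, ← Finset.sum_add_distrib]
    refine Finset.sum_congr rfl fun q _ => ?_
    split_ifs <;> simp
  have b_up := two_mul_markerSum_one_le (t := t) (x := y) (lo := a) (l := l)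
  have b_low := lt_mul_markerSum_one_add_one (lo := a + s) (by omega) hδ hl hd
  rw [show a + s + l = a + l + s by omega, mid] at b_low
  have b0 := markerSum_one_nonneg (t := t) (x := y) (lo := a) (hi := a + l)
  have k10 := markerSum_one_nonneg (t := t) (x := x) (lo := a - 2 * t) (hi := a + s)
  have k20 := markerSum_one_nonneg (t := t) (x := x) (lo := a + l + s) (hi := a + L + s)
  have k10' := markerSum_one_nonneg (t := t) (x := y) (lo := a - 2 * t) (hi := a)
  have k20' := markerSum_one_nonneg (t := t) (x := y) (lo := a + l) (hi := a + L + s)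
  have k1 := markerSum_one_le (t := t) (x := x) (lo := a - 2 * t) (hi := a + s) (k := 3 * t)
    (by omega)
  have k2 := markerSum_one_le (t := t) (x := x) (lo := a + l + s) (hi := a + L + s) (k := 3 * t)
    (by omega)
  have k1' := markerSum_one_le (t := t) (x := y) (lo := a - 2 * t) (hi := a) (k := 3 * t)
    (by omega)
  have k2' := markerSum_one_le (t := t) (x := y) (lo := a + l) (hi := a + L + s) (k := 3 * t)
    (by omega)
  have e1 := abs_markerSum_sub_le (t := t) (x := x) (lo := a - 2 * t) (hi := a + s) (k := 3 * t)
    (p := a) (E := 3 * t) (by positivity) (by omega) (fun q _ _ => by rw [abs_le]; lia)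
  have e2 := abs_markerSum_sub_le (t := t) (x := x) (lo := a + l + s) (hi := a + L + s)
    (k := 3 * t) (p := a + l) (E := 3 * t) (by positivity) (by omega)
    (fun q _ _ => by rw [abs_le]; lia)
  have e1' := abs_markerSum_sub_le (t := t) (x := y) (lo := a - 2 * t) (hi := a) (k := 3 * t)
    (p := a) (E := 3 * t) (by positivity) (by omega) (fun q _ _ => by rw [abs_le]; lia)
  have e2' := abs_markerSum_sub_le (t := t) (x := y) (lo := a + l) (hi := a + L + s)
    (k := 3 * t) (p := a + l) (E := 3 * t) (by positivity) (by omega)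
    (fun q _ _ => by rw [abs_le]; lia)
  rw [splitx, splity, left, right, mid] at hc
  rw [splitx, splity, left, right, mid'] at hS
  generalize markerSum t y (fun _ => 1) a (a + l) = b at *
  generalize markerSum t x (fun _ => 1) (a - 2 * t) (a + s) = c1 at *
  generalize markerSum t x (fun _ => 1) (a + l + s) (a + L + s) = c2 at *
  generalize markerSum t y (fun _ => 1) (a - 2 * t) a = c1' at *
  generalize markerSum t y (fun _ => 1) (a + l) (a + L + s) = c2' at *
  have hk : c1 + c2 = c1' + c2' := by
    have := Int.eq_zero_of_abs_lt_dvd hc.dvd (by rw [abs_lt]; constructor <;> push_cast at * <;> lia)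
    lia
  set d1 := markerSum t x (fun q => q) (a - 2 * t) (a + s)
  set d2 := markerSum t x (fun q => q) (a + l + s) (a + L + s)
  set d1' := markerSum t y (fun q => q) (a - 2 * t) a
  set d2' := markerSum t y (fun q => q) (a + l) (a + L + s)
  obtain ⟨E, hE, hE'⟩ : ∃ E : ℤ, |E| ≤ 36 * t ^ 2 ∧
      s * b + d1 + d2 - d1' - d2' = s * b + (c2 - c2') * l + E := by
    refine ⟨_, ?_, (add_sub_cancel _ _).symm⟩
    have : s * b + d1 + d2 - d1' - d2' - (s * b + (c2 - c2') * l) =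
        (d1 - c1 * a) + (d2 - c2 * (a + l)) - (d1' - c1' * a) - (d2' - c2' * (a + l)) := by
      linear_combination a * hk
    rw [this, abs_le]
    rw [abs_le] at e1 e2 e1' e2'
    push_cast at *
    constructor <;> nlinarith
  have hsb : 2 * (s * b) ≤ l + 2 * t := by
    have : (s : ℤ) * b ≤ t * b := by gcongr
    linarith
  have hsb0 : b ≤ s * b := le_mul_of_one_le_left b0 (by exact_mod_cast hs)
  have hn1 : (l : ℤ) + 1 ≤ n := by lia
  have ht1 : (1 : ℤ) ≤ t := by lia
  have hD : s * b + (c2 - c2') * l + E = 0 := by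
    have hl0 : (0 : ℤ) ≤ l := by positivity
    have hcl : |(c2 - c2') * (l : ℤ)| ≤ 3 * t * l := by
      rw [abs_mul, abs_of_nonneg hl0]
      gcongr
      rw [abs_le]; push_cast at *; constructor <;> linarith
    have hbound : (4 : ℤ) * t * l + 37 * t ^ 2 + t < 100 * t ^ 2 * n := by
      have i1 := mul_le_mul_of_nonneg_right ht1 (by positivity : (0 : ℤ) ≤ t * l)
      have i2 := mul_le_mul_of_nonneg_left hn1 (by positivity : (0 : ℤ) ≤ (t : ℤ) ^ 2)
      have i3 := mul_le_mul_of_nonneg_right ht1 (by positivity : (0 : ℤ) ≤ t)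
      have i4 : (0 : ℤ) ≤ t ^ 2 * l := by positivity
      linarith
    have hll : (l : ℤ) ≤ t * l := le_mul_of_one_le_left hl0 ht1
    rw [← hE']
    refine Int.eq_zero_of_abs_lt_dvd (m := (100 * t ^ 2 * n : ℕ)) ?_ ?_
    · have := hS.symm.dvd
      convert this using 1
      ring
    · rw [hE']
      rw [abs_le] at hE hcl
      push_cast
      rw [abs_lt]
      constructor <;> linarith
  have hlbig : (199 : ℤ) * (t ^ 2 * δ) < L := by
    have : 199 * (t ^ 2 * δ) < L := by lia
    exact_mod_cast this
  have hlbig' : (197 : ℤ) * t ^ 2 < l := by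
    have : 197 * t ^ 2 < l := by lia
    exact_mod_cast this
  have htt' : (t : ℤ) ≤ t ^ 2 := by exact_mod_cast htt
  rw [abs_le] at hE
  rcases lt_trichotomy (c2 - c2') 0 with h | h | h
  · have : (c2 - c2') * l ≤ (-1) * l := by gcongr; lia
    linarith
  · rw [h, zero_mul] at hD
    have hb : b + 1 ≤ 37 * t ^ 2 := by linarith
    have : (b + 1) * δ ≤ 37 * t ^ 2 * δ := by gcongr
    have h0 : (0 : ℤ) ≤ t ^ 2 * δ := by positivity
    linarith
  · have : 1 * (l : ℤ) ≤ (c2 - c2') * l := by gcongr; lia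
    linarith

lemma exists_coloring_of_card_filter_le {α : Type*} (S : Finset α) (R : α → α → Prop)
    [DecidableRel R] (hR : ∀ x y, R x y → R y x) (d : ℕ)
    (hd : ∀ x ∈ S, (S.filter (R x)).card ≤ d) :
    ∃ col : α → Fin (d + 1), ∀ x ∈ S, ∀ y ∈ S, R x y → col x = col y → x = y := by
  classical
  suffices H : ∀ T : Finset α, T ⊆ S →
      ∃ col : α → Fin (d + 1), ∀ x ∈ T, ∀ y ∈ T, R x y → col x = col y → x = y from
    H S subset_rfl
  intro T
  induction T using Finset.induction_on with
  | empty => exact fun _ => ⟨fun _ => 0, by simp⟩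
  | insert a T ha ih =>
    intro hT
    obtain ⟨col, hcol⟩ := ih ((Finset.subset_insert a T).trans hT)
    have hcard : ((S.filter (R a)).image col).card < (Finset.univ : Finset (Fin (d + 1))).card := by
      rw [Finset.card_univ, Fintype.card_fin]
      exact Nat.lt_succ_of_le (Finset.card_image_le.trans (hd a (hT (Finset.mem_insert_self a T))))
    obtain ⟨k, -, hk⟩ := Finset.exists_mem_notMem_of_card_lt_card hcard
    have hne : ∀ y ∈ T, R a y → k ≠ col y := fun y hy hay h =>
      hk (h ▸ Finset.mem_image_of_mem col
        (Finset.mem_filter.2 ⟨hT (Finset.mem_insert_of_mem hy), hay⟩))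
    have hTa : ∀ y ∈ T, y ≠ a := fun y hy h => ha (h ▸ hy)
    refine ⟨Function.update col a k, fun x hx y hy hxy => ?_⟩
    rcases Finset.mem_insert.1 hx with hxa | hxT <;> rcases Finset.mem_insert.1 hy with hya | hyT
    · exact fun _ => hxa.trans hya.symm
    · subst hxa
      rw [Function.update_self, Function.update_of_ne (hTa y hyT)]
      exact fun h => absurd h (hne y hyT hxy)
    · subst hya
      rw [Function.update_self, Function.update_of_ne (hTa x hxT)]
      exact fun h => absurd h.symm (hne x hxT (hR _ _ hxy))
    · rw [Function.update_of_ne (hTa x hxT), Function.update_of_ne (hTa y hyT)]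
      exact hcol x hxT y hyT hxy

lemma exists_hash_of_bset_inter (t : ℕ) : ∃ C : ℕ, 0 < C ∧ ∀ N : ℕ, 0 < N →
    ∃ h : List Bool → ℕ, ∀ x y : List Bool, x.length ≤ N → y.length ≤ N →
      (Bset t x ∩ Bset t y).Nonempty → h x ≡ h y [MOD C * N ^ 2] → x = y := by
  classical
  set V : Finset (List Bool) := (List.finite_length_le Bool t).toFinset with hV
  refine ⟨4 * ((t + 1) * V.card) + 1, by omega, fun N hN => ?_⟩
  set S : Finset (List Bool) := (List.finite_length_le Bool N).toFinset with hS
  have hmem : ∀ x, x ∈ S ↔ x.length ≤ N := by simp [hS]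
  set P := Finset.range (N + 1) ×ˢ Finset.range (t + 1) ×ˢ Finset.range (N + 1) ×ˢ V with hP
  have hcard : P.card ≤ 4 * ((t + 1) * V.card) * N ^ 2 := by
    simp only [hP, Finset.card_product, Finset.card_range]
    calc (N + 1) * ((t + 1) * ((N + 1) * V.card)) = (t + 1) * V.card * (N + 1) ^ 2 := by ring
      _ ≤ (t + 1) * V.card * (2 * N) ^ 2 := by gcongr; omega
      _ = _ := by ring
  obtain ⟨col, hcol⟩ := exists_coloring_of_card_filter_le S
    (fun x y => (Bset t x ∩ Bset t y).Nonempty) (fun x y h => by rwa [Set.inter_comm])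
    P.card (by
      intro x hx
      have hsub : S.filter (fun y => (Bset t x ∩ Bset t y).Nonempty) ⊆ P.image fun p =>
          (x.take p.1 ++ x.drop (p.1 + p.2.1)).take p.2.2.1 ++ p.2.2.2 ++
            (x.take p.1 ++ x.drop (p.1 + p.2.1)).drop p.2.2.1 := by
        intro y hy
        obtain ⟨hyS, z, ⟨u, v, w, hx', hz, hv⟩, u', v', w', hy', hz', hv'⟩ :=
          Finset.mem_filter.1 hy
        rw [hmem] at hyS hx
        subst hx' hy'
        simp only [List.length_append] at hx hyS
        refine Finset.mem_image.2 ⟨(u.length, v.length, u'.length, v'), ?_, ?_⟩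
        · simp only [hP, hV, Finset.mem_product, Finset.mem_range, Set.Finite.mem_toFinset,
            Set.mem_ofPred_eq]
          omega
        · have hd : (u ++ v ++ w).take u.length ++ (u ++ v ++ w).drop (u.length + v.length) =
              u' ++ w' := by
            rw [← hz', hz, ← List.length_append, List.drop_left, List.append_assoc, List.take_left]
          simp only [hd, List.take_left, List.drop_left]
      exact (Finset.card_le_card hsub).trans Finset.card_image_le)
  refine ⟨fun x => col x, fun x y hx hy hxy h => ?_⟩
  refine hcol x ((hmem x).2 hx) y ((hmem y).2 hy) hxy (Fin.ext ?_)
  have hN2 : 0 < N ^ 2 := by positivity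
  have hlt : P.card + 1 ≤ (4 * ((t + 1) * V.card) + 1) * N ^ 2 := by
    rw [add_mul]; omega
  exact Nat.ModEq.eq_of_lt_of_lt h ((col x).2.trans_le hlt) ((col y).2.trans_le hlt)

/-- The sum of the hashes of the consecutive length `2 * W` windows of `c`, starting at `o`. -/
def windowHash (K : ℕ) (h : List Bool → ℕ) (W n o : ℕ) (c : List Bool) : ZMod K :=
  ∑ k ∈ Finset.range n, (h ((c.drop (2 * W * k + o)).take (2 * W)) : ZMod K)

lemma eq_of_windowHash_eq {t W n K : ℕ} {h : List Bool → ℕ} (hW : 0 < W)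
    (hh : ∀ x y : List Bool, x.length ≤ 2 * W → y.length ≤ 2 * W →
      (Bset t x ∩ Bset t y).Nonempty → h x ≡ h y [MOD K] → x = y)
    {u v B v' D : List Bool} (hu : u.length < n) (hv : v.length ≤ t) (hv' : v'.length = v.length)
    (hB : B.length + v.length ≤ W)
    (h0 : windowHash K h W n 0 (u ++ (v ++ B) ++ D) = windowHash K h W n 0 (u ++ (B ++ v') ++ D))
    (h1 : windowHash K h W n W (u ++ (v ++ B) ++ D) = windowHash K h W n W (u ++ (B ++ v') ++ D)) :
    v ++ B = B ++ v' := by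
  obtain ⟨k, o, ho, hke, hr⟩ : ∃ k o, (o = 0 ∨ o = W) ∧ 2 * W * k + o ≤ u.length ∧
      u.length < 2 * W * k + o + W := by
    have hq := Nat.div_add_mod u.length W
    have hlt := Nat.mod_lt u.length hW
    rcases Nat.even_or_odd' (u.length / W) with ⟨k, hk | hk⟩
    · refine ⟨k, 0, Or.inl rfl, ?_⟩
      rw [hk, show W * (2 * k) = 2 * W * k by ring] at hq
      omega
    · refine ⟨k, W, Or.inr rfl, ?_⟩
      rw [hk, show W * (2 * k + 1) = 2 * W * k + W by ring] at hq
      omega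
  have hsum : windowHash K h W n o (u ++ (v ++ B) ++ D) =
      windowHash K h W n o (u ++ (B ++ v') ++ D) := by
    rcases ho with rfl | rfl
    exacts [h0, h1]
  have hkn : k ∈ Finset.range n := by
    rw [Finset.mem_range]
    have : k ≤ 2 * W * k := Nat.le_mul_of_pos_left k (by omega)
    omega
  unfold windowHash at hsum
  rw [← Finset.add_sum_erase _ _ hkn, ← Finset.add_sum_erase _ _ hkn,
    Finset.sum_congr (g := fun j => (h (((u ++ (B ++ v') ++ D).drop (2 * W * j + o)).take (2 * W)) :
      ZMod K)) rfl, add_left_inj, ZMod.natCast_eq_natCast_iff] at hsum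
  · set e := 2 * W * k + o with he
    set m := 2 * W - (u.length - e) - (B.length + v.length) with hm
    have win : ∀ X : List Bool, X.length = B.length + v.length →
        ((u ++ X ++ D).drop e).take (2 * W) = u.drop e ++ X ++ D.take m := by
      intro X hX
      rw [List.append_assoc, List.drop_append_of_le_length hke, List.take_append,
        List.take_of_length_le (by rw [List.length_drop]; omega), List.take_append,
        List.take_of_length_le (by rw [List.length_drop]; omega), List.length_drop, hX,
        List.append_assoc]
    rw [win _ (by simp; omega), win _ (by simp; omega)] at hsum
    have := hh _ _ (by simp; omega) (by simp; omega)
      ⟨u.drop e ++ (B ++ D.take m), ⟨u.drop e, v, B ++ D.take m, by simp, rfl, hv⟩,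
        u.drop e ++ B, v', D.take m, by simp, by simp, by omega⟩ hsum
    rw [List.append_cancel_right_eq, List.append_cancel_left_eq] at this
    exact this
  · intro j hj
    have hjk := (Finset.mem_erase.1 hj).1
    congr 2
    refine List.ext_getElem? fun i => ?_
    rw [List.getElem?_take, List.getElem?_take]
    split_ifs with hi
    · rw [List.getElem?_drop, List.getElem?_drop]
      rcases lt_or_gt_of_ne hjk with hlt | hlt
      · have : 2 * W * (j + 1) ≤ 2 * W * k := Nat.mul_le_mul_left _ hlt
        rw [mul_add, mul_one] at this
        rw [List.append_assoc, List.append_assoc, List.getElem?_append_left (by omega),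
          List.append_assoc, List.append_assoc, List.getElem?_append_left (by omega)]
      · have : 2 * W * (k + 1) ≤ 2 * W * j := Nat.mul_le_mul_left _ hlt
        rw [mul_add, mul_one] at this
        rw [List.getElem?_append_right (by simp; omega), List.getElem?_append_right (by simp; omega)]
        congr 1
        simp; omega
    · rfl

lemma DenseStr.exists_hasMarkerAt {t δ i : ℕ} {x : List Bool} (hc : DenseStr (pat t) δ x)
    (hi : i + δ ≤ x.length) :
    ∃ q, i ≤ q ∧ q + 2 * t ≤ i + δ ∧ HasMarkerAt t (fun j => x[j]?) q := by
  obtain ⟨p, r, hpr⟩ := hc ((x.drop i).take δ)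
    ((List.take_prefix _ _).isInfix.trans (List.drop_suffix _ _).isInfix)
    (by simp; omega)
  have hlen := congrArg List.length hpr
  simp only [pat, List.length_append, List.length_replicate, List.length_take,
    List.length_drop] at hlen
  have hget : ∀ j < 2 * t, x[i + p.length + j]? = (pat t)[j]? := by
    intro j hj
    have h1 : ((x.drop i).take δ)[p.length + j]? = x[i + p.length + j]? := by
      rw [List.getElem?_take_of_lt (by omega), List.getElem?_drop, add_assoc]
    rw [← h1, ← hpr, List.append_assoc, List.getElem?_append_right (by omega),
      List.getElem?_append_left (by simp [pat]; omega)]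
    congr 1; omega
  refine ⟨i + p.length, by omega, by omega, fun j hj => ?_, fun j hj => ?_⟩
  · simp only
    rw [hget j (by omega), pat, List.getElem?_append_left (by simpa)]
    simp [hj]
  · simp only
    rw [add_assoc _ t j, hget (t + j) (by omega), pat, List.getElem?_append_right (by simp)]
    simp [hj]

lemma eq_of_marker_hash_eq {t n δ W K : ℕ} {h : List Bool → ℕ} (ht : 1 ≤ t) (hδ : 0 < δ)
    (hW : W = 200 * t ^ 2 * δ)
    (hh : ∀ x y : List Bool, x.length ≤ 2 * W → y.length ≤ 2 * W →
      (Bset t x ∩ Bset t y).Nonempty → h x ≡ h y [MOD K] → x = y)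
    {x x' : List Bool} (hc : x.length = n) (hc' : x'.length = n)
    (hd : DenseStr (pat t) δ x) (hd' : DenseStr (pat t) δ x')
    (hcount : markerSum t (fun j => x[j]?) (fun _ => 1) 0 n ≡
      markerSum t (fun j => x'[j]?) (fun _ => 1) 0 n [ZMOD (11 * t : ℕ)])
    (hsum : markerSum t (fun j => x[j]?) (fun q => q) 0 n ≡
      markerSum t (fun j => x'[j]?) (fun q => q) 0 n [ZMOD (100 * t ^ 2 * n : ℕ)])
    (h0 : windowHash K h W n 0 x = windowHash K h W n 0 x')
    (h1 : windowHash K h W n W x = windowHash K h W n W x')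
    (hB : (Bset t x ∩ Bset t x').Nonempty) : x = x' := by
  obtain ⟨z, ⟨u, v, w, rfl, hz, hv⟩, u', v', w', rfl, hz', hv'⟩ := hB
  wlog huu : u.length ≤ u'.length generalizing u v w u' v' w'
  · exact (this u' v' w' hc' hd' hz' hv' u v w hc hd hcount.symm hsum.symm h0.symm h1.symm hz hv
      (by omega)).symm
  rw [hz] at hz'
  obtain ⟨B, rfl⟩ : u <+: u' := List.prefix_of_prefix_length_le (List.prefix_append u w)
    (hz' ▸ List.prefix_append u' w') huu
  rw [List.append_assoc, List.append_cancel_left_eq] at hz'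
  subst hz'
  simp only [List.length_append] at hc hc'
  rcases Nat.eq_zero_or_pos v.length with hv0 | hv0
  · have hv0' : v'.length = 0 := by omega
    rw [List.length_eq_zero_iff] at hv0 hv0'
    simp [hv0, hv0']
  have e1 : u ++ v ++ (B ++ w') = u ++ (v ++ B) ++ w' := by simp
  have e2 : u ++ B ++ v' ++ w' = u ++ (B ++ v') ++ w' := by simp
  rw [e1] at hd
  rw [e1, e2] at hcount hsum h0 h1 ⊢
  have hgap : B.length + v.length ≤ 200 * t ^ 2 * δ := by
    refine burst_gap_le (a := u.length) (n := n) (x := fun j => (u ++ (v ++ B) ++ w')[j]?)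
      (y := fun j => (u ++ (B ++ v') ++ w')[j]?) hv0 hv ?_ ?_ ?_ (by omega) hδ ?_ hcount hsum
    · intro q hq
      simp only [List.append_assoc]
      rw [List.getElem?_append_left hq, List.getElem?_append_left hq]
    · intro q hq hq'
      simp only [List.append_assoc]
      rw [List.getElem?_append_right (by omega), List.getElem?_append_right (by omega),
        List.getElem?_append_left (l₁ := B) (by omega), List.getElem?_append_right (by omega),
        List.getElem?_append_left (by omega)]
      congr 1; omega
    · intro q hq
      rw [List.getElem?_append_right (by simp; omega), List.getElem?_append_right (by simp; omega)]
      congr 1; simp; omega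
    · intro i _ hi
      exact hd.exists_hasMarkerAt (by simp; omega)
  rw [eq_of_windowHash_eq (by rw [hW]; positivity) hh (by omega) hv (by omega) (hW ▸ hgap) h0 h1]

lemma cast_clog_le_two_mul_logb {n : ℕ} (hn : 2 ≤ n) :
    (Nat.clog 2 n : ℝ) ≤ 2 * Real.logb 2 n := by
  have h1 : (2 : ℝ) ^ ((Nat.clog 2 n : ℝ) - 1) ≤ n := by
    have h := (Nat.pow_pred_clog_lt_self one_lt_two (by omega : 1 < n)).le
    have hpos := Nat.clog_pos one_lt_two hn
    rw [show ((Nat.clog 2 n : ℝ) - 1) = ((Nat.clog 2 n - 1 : ℕ) : ℝ) by push_cast [hpos]; ring,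
      Real.rpow_natCast]
    exact_mod_cast h
  have h2 : (Nat.clog 2 n : ℝ) - 1 ≤ Real.logb 2 n := by
    rwa [Real.le_logb_iff_rpow_le one_lt_two (by positivity)]
  have h3 : 1 ≤ Real.logb 2 n := by
    rw [Real.le_logb_iff_rpow_le one_lt_two (by positivity), Real.rpow_one]
    exact_mod_cast hn
  linarith

lemma cast_clog_le_logb_add_one {T : ℕ} (hT : 2 ≤ T) :
    (Nat.clog 2 T : ℝ) ≤ Real.logb 2 T + 1 := by
  have h := (Nat.pow_pred_clog_lt_self one_lt_two (by omega : 1 < T)).le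
  have hpos := Nat.clog_pos one_lt_two hT
  have h2 : (Nat.clog 2 T : ℝ) - 1 ≤ Real.logb 2 T := by
    rw [Real.le_logb_iff_rpow_le one_lt_two (by positivity),
      show ((Nat.clog 2 T : ℝ) - 1) = ((Nat.clog 2 T - 1 : ℕ) : ℝ) by push_cast [hpos]; ring,
      Real.rpow_natCast]
    exact_mod_cast h
  linarith

theorem stmt_2 (t : ℕ) (ht : 1 ≤ t) (ε : ℝ) (hε : 0 < ε) :
    ∃ γ : ℝ, ∃ n₀ : ℕ, ∀ n : ℕ, n₀ ≤ n →
      ∃ m : ℕ, 0 < m ∧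
        (m : ℝ) ≤ Real.logb 2 n + (8 + ε) * Real.logb 2 (Real.logb 2 n) + γ ∧
        ∃ f : List Bool → (Fin m → Bool),
          ∀ c c' : List Bool, c.length = n → c'.length = n →
            DenseStr (pat t) (t * 2 ^ (t + 1) * Nat.clog 2 n) c →
            DenseStr (pat t) (t * 2 ^ (t + 1) * Nat.clog 2 n) c' →
            f c = f c' → (Bset t c ∩ Bset t c').Nonempty → c = c' := by
  obtain ⟨C, hC, hhash⟩ := exists_hash_of_bset_inter t
  set A : ℕ := 11 * t * (100 * t ^ 2) * (C * (2 * (200 * t ^ 2 * (t * 2 ^ (t + 1)))) ^ 2) ^ 2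
    with hA
  have hApos : 0 < A := by positivity
  refine ⟨Real.logb 2 A + 5, 4, fun n hn => ?_⟩
  set l := Nat.clog 2 n with hl
  have hlpos : 0 < l := Nat.clog_pos one_lt_two (by omega)
  set δ := t * 2 ^ (t + 1) * l with hδ
  have hδpos : 0 < δ := by positivity
  set W := 200 * t ^ 2 * δ with hW
  have hWpos : 0 < W := by positivity
  obtain ⟨h, hh⟩ := hhash (2 * W) (by positivity)
  set K := C * (2 * W) ^ 2 with hK
  have hKpos : 0 < K := by positivity
  set T := 11 * t * ((100 * t ^ 2 * n) * (K * K)) with hT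
  have hTeq : T = A * (n * l ^ 4) := by
    rw [hT, hK, hW, hδ, hA]; ring
  have hT2 : 2 ≤ T := by
    have h1 : 1 ≤ A * l ^ 4 := Nat.one_le_iff_ne_zero.2 (by positivity)
    calc 2 ≤ 1 * n := by omega
      _ ≤ A * l ^ 4 * n := by gcongr
      _ = T := by rw [hTeq]; ring
  refine ⟨Nat.clog 2 T, Nat.clog_pos one_lt_two hT2, ?_, ?_⟩
  · have hlog2 : (2 : ℝ) ≤ Real.logb 2 n := by
      rw [Real.le_logb_iff_rpow_le one_lt_two (by positivity)]
      norm_num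
      exact_mod_cast hn
    have hll : 0 ≤ Real.logb 2 (Real.logb 2 n) :=
      Real.logb_nonneg one_lt_two (by linarith)
    have hl' : Real.logb 2 l ≤ 1 + Real.logb 2 (Real.logb 2 n) := by
      calc Real.logb 2 l ≤ Real.logb 2 (2 * Real.logb 2 n) :=
            Real.logb_le_logb_of_le one_lt_two (by exact_mod_cast hlpos)
              (cast_clog_le_two_mul_logb (by omega))
        _ = _ := by
          rw [Real.logb_mul two_ne_zero (by linarith), Real.logb_self_eq_one one_lt_two]
    have hlogT : Real.logb 2 T = Real.logb 2 A + (Real.logb 2 n + 4 * Real.logb 2 l) := by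
      have hA0 : (A : ℝ) ≠ 0 := by exact_mod_cast hApos.ne'
      have hn0 : (n : ℝ) ≠ 0 := by exact_mod_cast (by omega : n ≠ 0)
      have hl0 : (l : ℝ) ≠ 0 := by exact_mod_cast hlpos.ne'
      rw [hTeq]
      push_cast
      rw [Real.logb_mul hA0 (mul_ne_zero hn0 (pow_ne_zero 4 hl0)),
        Real.logb_mul hn0 (pow_ne_zero 4 hl0), Real.logb_pow]
      norm_num
    have := cast_clog_le_logb_add_one hT2
    have : 0 ≤ (4 + ε) * Real.logb 2 (Real.logb 2 n) := by positivity
    linarith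
  · have : NeZero (11 * t) := ⟨by positivity⟩
    have : NeZero (100 * t ^ 2 * n) := ⟨by positivity⟩
    have : NeZero K := ⟨hKpos.ne'⟩
    obtain ⟨φ⟩ : Nonempty ((ZMod (11 * t) × ZMod (100 * t ^ 2 * n) × ZMod K × ZMod K) ↪
        (Fin (Nat.clog 2 T) → Bool)) := by
      refine Function.Embedding.nonempty_of_card_le ?_
      simp only [Fintype.card_prod, ZMod.card, Fintype.card_pi, Fintype.card_bool,
        Finset.prod_const, Finset.card_univ, Fintype.card_fin]
      exact Nat.le_pow_clog one_lt_two T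
    refine ⟨fun x => φ (markerSum t (fun j => x[j]?) (fun _ => 1) 0 n,
      markerSum t (fun j => x[j]?) (fun q => q) 0 n, windowHash K h W n 0 x,
      windowHash K h W n W x), fun c c' hc hc' hd hd' hf hB => ?_⟩
    simp only [EmbeddingLike.apply_eq_iff_eq, Prod.mk.injEq, ZMod.intCast_eq_intCast_iff] at hf
    exact eq_of_marker_hash_eq ht hδpos hW hh hc hc' hd hd' hf.1 hf.2.1 hf.2.2.1 hf.2.2.2 hB
end

section
/- For every integer t ≥ 1 and every real ε > 0 there exist a constant γ (depending only on t and ε) and an integer n₀ such that for all n ≥ n₀ there exist an integer N and an injective encoding map E : {0,1}^{n−1} → {0,1}^N such that N − (n−1) ≤ log₂ n + (9+ε)·log₂ log₂ n + γ, and the binary code C = {E(a) : a ∈ {0,1}^{n−1}} corrects a burst of at most t deletions, i.e., for all distinct a, a' ∈ {0,1}^{n−1}, B_{≤t}(E(a)) ∩ B_{≤t}(E(a')) = ∅. -/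
/-- `x` and `y` become equal after deleting the `s` symbols of `x` at position `i` and the
`s` symbols of `y` at position `j`, where `i ≤ j`. -/
structure BurstShift {α : Type*} (s i j : ℕ) (x y : ℕ → α) : Prop where
  le : i ≤ j
  left : ∀ k < i, x k = y k
  mid : ∀ k, i ≤ k → k < j → y k = x (k + s)
  right : ∀ k, j + s ≤ k → x k = y k

/-- The word `1 0^t` occurs in `x` at position `k`. -/
def PatternAt (t : ℕ) (x : ℕ → Bool) (k : ℕ) : Prop :=
  x k = true ∧ ∀ r < t, x (k + 1 + r) = false

open Classical in
/-- Indicator function of the occurrences of `1 0^t` in `x`. -/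
noncomputable def patternInd (t : ℕ) (x : ℕ → Bool) (k : ℕ) : ℤ :=
  if PatternAt t x k then 1 else 0

/-- The number of occurrences of `1 0^t` in `x` before position `k`. -/
noncomputable def patternCount (t : ℕ) (x : ℕ → Bool) (k : ℕ) : ℤ :=
  ∑ m ∈ Finset.range k, patternInd t x m

theorem patternInd_nonneg (t : ℕ) (x : ℕ → Bool) (k : ℕ) : 0 ≤ patternInd t x k := by
  unfold patternInd; split_ifs <;> simp

theorem patternInd_le_one (t : ℕ) (x : ℕ → Bool) (k : ℕ) : patternInd t x k ≤ 1 := by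
  unfold patternInd; split_ifs <;> simp

theorem patternInd_congr {t : ℕ} {x y : ℕ → Bool} {k l : ℕ}
    (h : ∀ r ≤ t, x (k + r) = y (l + r)) : patternInd t x k = patternInd t y l := by
  have : PatternAt t x k ↔ PatternAt t y l := by
    unfold PatternAt
    have h0 : x k = y l := h 0 (Nat.zero_le _)
    have h1 : ∀ r < t, x (k + 1 + r) = y (l + 1 + r) := fun r hr => by
      simpa [add_assoc, add_comm, add_left_comm] using h (r + 1) hr
    rw [h0]
    exact and_congr_right fun _ => forall₂_congr fun r hr => by rw [h1 r hr]
  unfold patternInd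
  by_cases h' : PatternAt t x k
  · rw [if_pos h', if_pos (this.1 h')]
  · rw [if_neg h', if_neg (mt this.2 h')]

theorem patternInd_add_eq_zero {t : ℕ} {x : ℕ → Bool} {k : ℕ} (h : PatternAt t x k) {r : ℕ}
    (hr : r < t) : patternInd t x (k + 1 + r) = 0 := by
  unfold patternInd
  rw [if_neg]
  intro h'
  simpa [h'.1] using h.2 r hr

theorem patternCount_succ (t : ℕ) (x : ℕ → Bool) (k : ℕ) :
    patternCount t x (k + 1) = patternCount t x k + patternInd t x k :=
  Finset.sum_range_succ _ _

theorem patternCount_add (t : ℕ) (x : ℕ → Bool) (k s : ℕ) :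
    patternCount t x (k + s) = patternCount t x k +
      ∑ r ∈ Finset.range s, patternInd t x (k + r) :=
  Finset.sum_range_add _ _ _

theorem patternCount_add_nonneg (t : ℕ) (x : ℕ → Bool) (k s : ℕ) :
    0 ≤ patternCount t x (k + s) - patternCount t x k := by
  rw [patternCount_add, add_sub_cancel_left]
  exact Finset.sum_nonneg fun _ _ => patternInd_nonneg _ _ _

theorem patternCount_add_of_patternAt {t : ℕ} {x : ℕ → Bool} {k : ℕ} (h : PatternAt t x k)
    {s : ℕ} (hs : s ≤ t) : patternCount t x (k + 1 + s) = patternCount t x (k + 1) := by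
  rw [patternCount_add, Finset.sum_eq_zero, add_zero]
  intro r hr
  exact patternInd_add_eq_zero h (lt_of_lt_of_le (Finset.mem_range.1 hr) hs)

theorem patternCount_add_le_one {t : ℕ} (x : ℕ → Bool) (k : ℕ) {s : ℕ} (hs : s ≤ t + 1) :
    patternCount t x (k + s) - patternCount t x k ≤ 1 := by
  induction s generalizing k with
  | zero => simp
  | succ s ih =>
    by_cases hk : PatternAt t x k
    · have h1 := patternCount_add_of_patternAt hk (s := s) (by omega)
      have h2 := patternCount_succ t x k
      have h3 := patternInd_le_one t x k
      rw [show k + (s + 1) = k + 1 + s by omega]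
      omega
    · have h2 := patternCount_succ t x k
      have h3 : patternInd t x k = 0 := if_neg hk
      have h4 := ih (k + 1) (by omega)
      rw [show k + (s + 1) = k + 1 + s by omega]
      omega

theorem abs_sub_le_of_abs_succ_sub_le {D : ℕ → ℤ} (h : ∀ k, |D (k + 1) - D k| ≤ 1) (k r : ℕ) :
    |D (k + r) - D k| ≤ r := by
  induction r with
  | zero => simp
  | succ r ih =>
    have := h (k + r)
    rw [← add_assoc]
    rw [abs_le] at *
    push_cast
    omega

/-- Every aligned window of length `w` contained in `[0, N)` contains an occurrence of `1 0^t`. -/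
def PatternDense (t w N : ℕ) (x : ℕ → Bool) : Prop :=
  ∀ q, (q + 1) * w ≤ N → ∃ p, q * w ≤ p ∧ p + 1 < (q + 1) * w ∧ PatternAt t x p

section Locator

variable {t s i j : ℕ} {x y : ℕ → Bool}

/-- Difference between the pattern counts of two words. -/
noncomputable def patternDiff (t : ℕ) (x y : ℕ → Bool) (k : ℕ) : ℤ :=
  patternCount t x k - patternCount t y k

theorem abs_patternDiff_succ_sub_le (t : ℕ) (x y : ℕ → Bool) (k : ℕ) :
    |patternDiff t x y (k + 1) - patternDiff t x y k| ≤ 1 := by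
  have h1 := patternInd_nonneg t x k
  have h2 := patternInd_nonneg t y k
  have h3 := patternInd_le_one t x k
  have h4 := patternInd_le_one t y k
  simp only [patternDiff, patternCount_succ]
  rw [abs_le]
  omega

namespace BurstShift

theorem patternDiff_eq_zero (h : BurstShift s i j x y) {k : ℕ} (hk : k + t ≤ i) :
    patternDiff t x y k = 0 := by
  unfold patternDiff patternCount
  rw [sub_eq_zero]
  refine Finset.sum_congr rfl fun m hm => patternInd_congr fun r hr => h.left _ ?_
  have := Finset.mem_range.1 hm
  omega

theorem abs_patternDiff_le_left (h : BurstShift s i j x y) {k : ℕ} (hk : k ≤ i) :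
    |patternDiff t x y k| ≤ t := by
  have h0 : patternDiff t x y (k - t) = 0 := by
    rcases le_total t k with h1 | h1
    · exact h.patternDiff_eq_zero (by omega)
    · simp [patternDiff, patternCount, Nat.sub_eq_zero_of_le h1]
  have := abs_sub_le_of_abs_succ_sub_le (abs_patternDiff_succ_sub_le t x y) (k - t) (k - (k - t))
  rw [h0, sub_zero, Nat.add_sub_cancel' (Nat.sub_le k t)] at this
  exact this.trans (by exact_mod_cast (by omega))

theorem patternDiff_mid (h : BurstShift s i j x y) {k : ℕ} (hk : i ≤ k) (hk' : k + t ≤ j) :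
    patternDiff t x y k = patternCount t x (i + s) - patternCount t y i -
      (patternCount t x (k + s) - patternCount t x k) := by
  induction k, hk using Nat.le_induction with
  | base => unfold patternDiff; ring
  | succ k hk ih =>
    have ih := ih (by omega)
    have h1 : patternInd t y k = patternInd t x (k + s) := patternInd_congr fun r hr => by
      rw [h.mid (k + r) (by omega) (by omega)]
      congr 1
      omega
    have h2 := patternCount_succ t x k
    have h3 := patternCount_succ t y k
    have h4 := patternCount_succ t x (k + s)
    unfold patternDiff at *
    rw [show k + 1 + s = k + s + 1 by omega]
    omega

theorem patternDiff_right (h : BurstShift s i j x y) {k : ℕ} (hk : j + s ≤ k) :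
    patternDiff t x y k = patternDiff t x y (j + s) := by
  induction k, hk using Nat.le_induction with
  | base => rfl
  | succ k hk ih =>
    have h1 : patternInd t x k = patternInd t y k := patternInd_congr fun r hr =>
      h.right (k + r) (by omega)
    have h2 := patternCount_succ t x k
    have h3 := patternCount_succ t y k
    unfold patternDiff at *
    omega

theorem abs_patternDiff_le_mid (h : BurstShift s i j x y) (hst : s ≤ t) {k : ℕ}
    (hk' : k + t ≤ j) : |patternDiff t x y k| ≤ t + 1 := by
  rcases le_total k i with hk | hk
  · exact (h.abs_patternDiff_le_left hk).trans (by omega)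
  · have h1 := h.patternDiff_mid hk hk'
    have h2 := h.patternDiff_mid (t := t) le_rfl (by omega)
    have h3 := patternCount_add_nonneg t x k s
    have h4 := patternCount_add_nonneg t x i s
    have h5 := patternCount_add_le_one (t := t) x k (s := s) (by omega)
    have h6 := patternCount_add_le_one (t := t) x i (s := s) (by omega)
    have h7 := h.abs_patternDiff_le_left (t := t) (le_refl i)
    rw [abs_le] at *
    omega

theorem abs_patternDiff_le (h : BurstShift s i j x y) (hst : s ≤ t) (hij : i + t ≤ j) (k : ℕ) :
    |patternDiff t x y k| ≤ 3 * t + 1 := by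
  have key : ∀ k ≤ j + s, |patternDiff t x y k| ≤ 3 * t + 1 := by
    intro k hk
    rcases le_total (k + t) j with hk' | hk'
    · exact (h.abs_patternDiff_le_mid hst hk').trans (by omega)
    · have h1 := h.abs_patternDiff_le_mid hst (k := j - t) (by omega)
      have h2 := abs_sub_le_of_abs_succ_sub_le (abs_patternDiff_succ_sub_le t x y) (j - t)
        (k - (j - t))
      rw [show j - t + (k - (j - t)) = k by omega] at h2
      have h3 : ((k - (j - t) : ℕ) : ℤ) ≤ 2 * t := by omega
      rw [abs_le] at *
      omega
  rcases le_total k (j + s) with hk | hk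
  · exact key k hk
  · rw [h.patternDiff_right hk]
    exact key _ le_rfl

theorem sum_abs_patternDiff_mid (h : BurstShift s i j x y) (hst : s ≤ t) :
    ∑ k ∈ Finset.Ico i (j - t), |patternDiff t x y k| =
      |∑ k ∈ Finset.Ico i (j - t), patternDiff t x y k| := by
  have hmem : ∀ k ∈ Finset.Ico i (j - t), i ≤ k ∧ k + t ≤ j := fun k hk => by
    have := Finset.mem_Ico.1 hk
    omega
  have h3 := fun k => patternCount_add_nonneg t x k s
  have h5 := fun k => patternCount_add_le_one (t := t) x k (s := s) (by omega)
  rcases le_or_gt (patternCount t x (i + s) - patternCount t y i) 0 with hd | hd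
  · have hneg : ∀ k ∈ Finset.Ico i (j - t), patternDiff t x y k ≤ 0 := fun k hk => by
      rw [h.patternDiff_mid (hmem k hk).1 (hmem k hk).2]
      have := h3 k
      omega
    rw [abs_of_nonpos (Finset.sum_nonpos hneg), ← Finset.sum_neg_distrib]
    exact Finset.sum_congr rfl fun k hk => abs_of_nonpos (hneg k hk)
  · have hpos : ∀ k ∈ Finset.Ico i (j - t), 0 ≤ patternDiff t x y k := fun k hk => by
      rw [h.patternDiff_mid (hmem k hk).1 (hmem k hk).2]
      have := h5 k
      omega
    rw [abs_of_nonneg (Finset.sum_nonneg hpos)]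
    exact Finset.sum_congr rfl fun k hk => abs_of_nonneg (hpos k hk)

theorem patternDiff_ne_zero (h : BurstShift s i j x y) (hs : 1 ≤ s) (hst : s ≤ t) {p : ℕ}
    (hp : i ≤ p) (hp' : p + 1 + t ≤ j) (hpat : PatternAt t x p) :
    patternDiff t x y p ≠ 0 ∨ patternDiff t x y (p + 1) ≠ 0 := by
  have h1 := h.patternDiff_mid (t := t) hp (by omega)
  have h2 := h.patternDiff_mid (t := t) (k := p + 1) (by omega) hp'
  have h3 := patternCount_add_of_patternAt hpat hst
  have h4 := patternCount_add_of_patternAt hpat (s := s - 1) (by omega)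
  rw [show p + 1 + (s - 1) = p + s by omega] at h4
  have h5 := patternCount_succ t x p
  have h6 : patternInd t x p = 1 := if_pos hpat
  omega

theorem le_sum_abs_patternDiff (h : BurstShift s i j x y) (hs : 1 ≤ s) (hst : s ≤ t) {w N : ℕ}
    (hx : PatternDense t w N x) (hjN : j ≤ N) {q : ℕ} (hq : i ≤ q * w) (K : ℕ)
    (hK : (q + K) * w + t ≤ j) :
    (K : ℤ) ≤ ∑ k ∈ Finset.Ico (q * w) ((q + K) * w), |patternDiff t x y k| := by
  induction K with
  | zero => simp
  | succ K ih =>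
    have hmul : (q + K + 1) * w = (q + K) * w + w := by ring
    have hle : q * w ≤ (q + K) * w := Nat.mul_le_mul_right _ (by omega)
    rw [← add_assoc] at hK ⊢
    rw [← Finset.sum_Ico_consecutive _ hle (by omega : (q + K) * w ≤ (q + K + 1) * w)]
    have ih := ih (by omega)
    obtain ⟨p, hp1, hp2, hp⟩ := hx (q + K) (by omega)
    have h1 : 1 ≤ ∑ k ∈ Finset.Ico ((q + K) * w) ((q + K + 1) * w), |patternDiff t x y k| := by
      have hmem : ∀ m, (m = p ∨ m = p + 1) → |patternDiff t x y m| ≤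
          ∑ k ∈ Finset.Ico ((q + K) * w) ((q + K + 1) * w), |patternDiff t x y k| := fun m hm =>
        Finset.single_le_sum (f := fun k => |patternDiff t x y k|) (fun _ _ => abs_nonneg _)
          (Finset.mem_Ico.2 (by omega))
      rcases h.patternDiff_ne_zero hs hst (p := p) (by omega) (by omega) hp with h0 | h0
      · exact (Int.one_le_abs h0).trans (hmem _ (Or.inl rfl))
      · exact (Int.one_le_abs h0).trans (hmem _ (Or.inr rfl))
    push_cast
    omega

theorem patternDiff_eq_zero_right (h : BurstShift s i j x y) (hst : s ≤ t) {N : ℕ}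
    (hij : i + t ≤ j) (hjN : j + s ≤ N)
    (hcount : ((3 * t + 2 : ℕ) : ℤ) ∣ patternCount t x N - patternCount t y N) {k : ℕ}
    (hk : j + s ≤ k) : patternDiff t x y k = 0 := by
  rw [h.patternDiff_right hk, ← h.patternDiff_right hjN]
  refine Int.eq_zero_of_abs_lt_dvd hcount ?_
  have := h.abs_patternDiff_le hst hij N
  push_cast
  omega

theorem sum_patternDiff_eq_zero (h : BurstShift s i j x y) (hst : s ≤ t) {N P : ℕ}
    (hij : i + t ≤ j) (hP : (3 * t + 1) * N < P)
    (hsum : (P : ℤ) ∣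
      ∑ k ∈ Finset.range N, patternCount t x k - ∑ k ∈ Finset.range N, patternCount t y k) :
    ∑ k ∈ Finset.range N, patternDiff t x y k = 0 := by
  unfold patternDiff
  rw [Finset.sum_sub_distrib]
  refine Int.eq_zero_of_abs_lt_dvd hsum ?_
  rw [← Finset.sum_sub_distrib]
  calc |∑ k ∈ Finset.range N, patternDiff t x y k|
      ≤ ∑ k ∈ Finset.range N, |patternDiff t x y k| := Finset.abs_sum_le_sum_abs _ _
    _ ≤ ∑ k ∈ Finset.range N, (3 * t + 1 : ℤ) :=
        Finset.sum_le_sum fun k _ => h.abs_patternDiff_le hst hij k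
    _ = ((3 * t + 1) * N : ℕ) := by simp; ring
    _ < P := by exact_mod_cast hP

theorem abs_sum_patternDiff_mid_le (h : BurstShift s i j x y) (hst : s ≤ t) {N P : ℕ}
    (hij : i + t ≤ j) (hjN : j + s ≤ N) (hP : (3 * t + 1) * N < P)
    (hcount : ((3 * t + 2 : ℕ) : ℤ) ∣ patternCount t x N - patternCount t y N)
    (hsum : (P : ℤ) ∣
      ∑ k ∈ Finset.range N, patternCount t x k - ∑ k ∈ Finset.range N, patternCount t y k) :
    |∑ k ∈ Finset.Ico i (j - t), patternDiff t x y k| ≤ 3 * t * (3 * t + 1) := by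
  have h0 := h.sum_patternDiff_eq_zero hst hij hP hsum
  rw [Finset.range_eq_Ico, ← Finset.sum_Ico_consecutive _ (Nat.zero_le (i - t))
      (by omega : i - t ≤ N),
    ← Finset.sum_Ico_consecutive _ (by omega : i - t ≤ i) (by omega : i ≤ N),
    ← Finset.sum_Ico_consecutive _ (by omega : i ≤ j - t) (by omega : j - t ≤ N),
    ← Finset.sum_Ico_consecutive _ (by omega : j - t ≤ j + s) (by omega : j + s ≤ N)] at h0
  have h1 : ∑ k ∈ Finset.Ico 0 (i - t), patternDiff t x y k = 0 :=
    Finset.sum_eq_zero fun k hk => h.patternDiff_eq_zero (by have := Finset.mem_Ico.1 hk; omega)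
  have h2 : ∑ k ∈ Finset.Ico (j + s) N, patternDiff t x y k = 0 :=
    Finset.sum_eq_zero fun k hk =>
      h.patternDiff_eq_zero_right hst hij hjN hcount (Finset.mem_Ico.1 hk).1
  have hb : ∀ a b : ℕ, |∑ k ∈ Finset.Ico a b, patternDiff t x y k| ≤ (b - a : ℕ) * (3 * t + 1) := by
    intro a b
    calc |∑ k ∈ Finset.Ico a b, patternDiff t x y k|
        ≤ ∑ k ∈ Finset.Ico a b, |patternDiff t x y k| := Finset.abs_sum_le_sum_abs _ _
      _ ≤ ∑ k ∈ Finset.Ico a b, (3 * t + 1 : ℤ) :=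
          Finset.sum_le_sum fun k _ => h.abs_patternDiff_le hst hij k
      _ = _ := by simp
  have h3 := hb (i - t) i
  have h4 := hb (j - t) (j + s)
  have h5 : ((i - (i - t) : ℕ) : ℤ) * (3 * t + 1) ≤ t * (3 * t + 1) :=
    mul_le_mul_of_nonneg_right (by omega) (by positivity)
  have h6 : ((j + s - (j - t) : ℕ) : ℤ) * (3 * t + 1) ≤ (2 * t) * (3 * t + 1) :=
    mul_le_mul_of_nonneg_right (by omega) (by positivity)
  rw [h1, h2] at h0
  rw [abs_le] at *
  constructor <;> nlinarith

/-- Two confusable pattern-dense words with the same pattern invariants can only be confused by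
bursts at nearby positions. -/
theorem sub_le (h : BurstShift s i j x y) (hs : 1 ≤ s) (hst : s ≤ t) {w N P : ℕ} (hw : t ≤ w)
    (hx : PatternDense t w N x) (hjN : j + s ≤ N) (hP : (3 * t + 1) * N < P)
    (hcount : ((3 * t + 2 : ℕ) : ℤ) ∣ patternCount t x N - patternCount t y N)
    (hsum : (P : ℤ) ∣
      ∑ k ∈ Finset.range N, patternCount t x k - ∑ k ∈ Finset.range N, patternCount t y k) :
    j + s ≤ i + (3 * t * (3 * t + 1) + 4) * w := by
  by_contra! hlt
  set K := 3 * t * (3 * t + 1) + 1 with hK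
  have hmul : (3 * t * (3 * t + 1) + 4) * w = K * w + 3 * w := by rw [hK]; ring
  have hq : i ≤ (i / w + 1) * w := by
    have := Nat.lt_div_mul_add (a := i) (b := w) (by omega)
    rw [add_mul]; omega
  have hq' : (i / w + 1) * w ≤ i + w := by
    have := Nat.div_mul_le_self i w
    rw [add_mul]; omega
  have hqK : (i / w + 1 + K) * w = (i / w + 1) * w + K * w := add_mul _ _ _
  have h1 := h.le_sum_abs_patternDiff hs hst hx (by omega) hq K (by omega)
  have h2 := h.abs_sum_patternDiff_mid_le hst (by omega) hjN hP hcount hsum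
  rw [← h.sum_abs_patternDiff_mid hst] at h2
  have h3 : ∑ k ∈ Finset.Ico ((i / w + 1) * w) ((i / w + 1 + K) * w), |patternDiff t x y k| ≤
      ∑ k ∈ Finset.Ico i (j - t), |patternDiff t x y k| :=
    Finset.sum_le_sum_of_subset_of_nonneg (Finset.Ico_subset_Ico hq (by omega))
      fun _ _ _ => abs_nonneg _
  have h4 : (K : ℤ) = 3 * t * (3 * t + 1) + 1 := by rw [hK]; push_cast; rfl
  omega

end BurstShift

end Locator

/-- Greedy colouring: if the neighbours of each vertex are enumerated by `ι`, then any palette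
larger than `ι` suffices. -/
theorem exists_coloring_of_card_lt {V ι γ : Type*} [Fintype V] [Fintype ι] [Fintype γ]
    (R : V → V → Prop) (nb : V → ι → V) (hR : ∀ x y, R x y → y ∈ Set.range (nb x))
    (hR' : ∀ x y, R x y → x ∈ Set.range (nb y)) (hcard : Fintype.card ι < Fintype.card γ) :
    ∃ c : V → γ, ∀ x y, R x y → c x = c y → x = y := by
  classical
  have : Nonempty γ := Fintype.card_pos_iff.1 (Nat.zero_lt_of_lt hcard)
  suffices h : ∀ S : Finset V, ∃ c : V → γ, ∀ x ∈ S, ∀ y ∈ S, R x y → c x = c y → x = y by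
    obtain ⟨c, hc⟩ := h Finset.univ
    exact ⟨c, fun x y => hc x (Finset.mem_univ _) y (Finset.mem_univ _)⟩
  intro S
  induction S using Finset.induction_on with
  | empty => exact ⟨fun _ => Classical.arbitrary γ, by simp⟩
  | insert v S hv ih =>
    obtain ⟨c, hc⟩ := ih
    obtain ⟨a, ha⟩ : ∃ a, a ∉ Finset.univ.image fun k => c (nb v k) := by
      by_contra! hall
      have := Finset.card_le_card (Finset.subset_iff.2 fun a (_ : a ∈ Finset.univ) => hall a)
      exact absurd (this.trans Finset.card_image_le) (by simpa using hcard)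
    have ha' : ∀ y ∈ Set.range (nb v), c y ≠ a := by
      rintro _ ⟨k, rfl⟩ h
      exact ha (Finset.mem_image.2 ⟨k, Finset.mem_univ _, h⟩)
    have hne : ∀ y ∈ S, y ≠ v := fun y hy h => hv (h ▸ hy)
    refine ⟨Function.update c v a, fun x hx y hy hxy hcxy => ?_⟩
    rcases Finset.mem_insert.1 hx with rfl | hxS <;> rcases Finset.mem_insert.1 hy with rfl | hyS
    · rfl
    · rw [Function.update_self, Function.update_of_ne (hne y hyS)] at hcxy
      exact absurd hcxy.symm (ha' _ (hR _ _ hxy))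
    · rw [Function.update_self, Function.update_of_ne (hne x hxS)] at hcxy
      exact absurd hcxy (ha' _ (hR' _ _ hxy))
    · rw [Function.update_of_ne (hne x hxS), Function.update_of_ne (hne y hyS)] at hcxy
      exact hc x hxS y hyS hxy hcxy

/-- Extension of a finite binary word by `false`. -/
def extendFalse {N : ℕ} (f : Fin N → Bool) (k : ℕ) : Bool :=
  if h : k < N then f ⟨k, h⟩ else false

theorem extendFalse_of_lt {N : ℕ} (f : Fin N → Bool) {k : ℕ} (h : k < N) :
    extendFalse f k = f ⟨k, h⟩ := dif_pos h

theorem extendFalse_of_le {N : ℕ} (f : Fin N → Bool) {k : ℕ} (h : N ≤ k) :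
    extendFalse f k = false := dif_neg (by omega)

theorem extendFalse_injective {N : ℕ} :
    Function.Injective (extendFalse : (Fin N → Bool) → ℕ → Bool) := fun f g h => by
  ext k
  simpa [extendFalse_of_lt _ k.2] using congrFun h k

/-- The data needed to recover a word of length `B` from one confusable with it by a burst of at
most `t` deletions. -/
abbrev BurstData (t B : ℕ) : Type :=
  Fin (t + 1) × Fin (B + 1) × Fin (B + 1) × Bool × (Fin t → Bool)

/-- The word confusable with `f` that is described by the given data. -/
def burstNeighbor {t B : ℕ} (f : Fin B → Bool) (d : BurstData t B) (k : Fin B) : Bool :=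
  match d with
  | (s, i, j, true, w) =>
    if (k : ℕ) < i then f k
    else if (k : ℕ) < j then extendFalse f (k + s)
    else if (k : ℕ) < j + s then extendFalse w (k - j)
    else f k
  | (s, i, j, false, w) =>
    if (k : ℕ) < i then f k
    else if (k : ℕ) < i + s then extendFalse w (k - i)
    else if (k : ℕ) < j + s then extendFalse f (k - s)
    else f k

namespace BurstShift

variable {t B s i j : ℕ} {f g : Fin B → Bool}

theorem right_mem_range (h : BurstShift s i j (extendFalse f) (extendFalse g)) (hst : s ≤ t)
    (hj : j + s ≤ B) : g ∈ Set.range (burstNeighbor (t := t) f) := by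
  have hij := h.le
  refine ⟨(⟨s, by omega⟩, ⟨i, by omega⟩, ⟨j, by omega⟩, true,
    fun r => extendFalse g (j + r)), ?_⟩
  funext k
  simp only [burstNeighbor]
  split_ifs with h1 h2 h3
  · simpa [extendFalse_of_lt _ k.2] using h.left k h1
  · rw [← h.mid k (by omega) h2, extendFalse_of_lt _ k.2]
  · rw [extendFalse_of_lt _ (by omega)]
    simp only
    rw [show j + (k - j) = (k : ℕ) by omega, extendFalse_of_lt _ k.2]
  · simpa [extendFalse_of_lt _ k.2] using h.right k (by omega)

theorem left_mem_range (h : BurstShift s i j (extendFalse f) (extendFalse g)) (hst : s ≤ t)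
    (hj : j + s ≤ B) : f ∈ Set.range (burstNeighbor (t := t) g) := by
  have hij := h.le
  refine ⟨(⟨s, by omega⟩, ⟨i, by omega⟩, ⟨j, by omega⟩, false,
    fun r => extendFalse f (i + r)), ?_⟩
  funext k
  simp only [burstNeighbor]
  split_ifs with h1 h2 h3
  · simpa [extendFalse_of_lt _ k.2] using (h.left k h1).symm
  · rw [extendFalse_of_lt _ (by omega)]
    simp only
    rw [show i + (k - i) = (k : ℕ) by omega, extendFalse_of_lt _ k.2]
  · rw [h.mid (k - s) (by omega) (by omega), show (k : ℕ) - s + s = k by omega,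
      extendFalse_of_lt _ k.2]
  · simpa [extendFalse_of_lt _ k.2] using (h.right k (by omega)).symm

end BurstShift

theorem card_burstData (t B : ℕ) :
    Fintype.card (BurstData t B) = (t + 1) * ((B + 1) * ((B + 1) * (2 * 2 ^ t))) := by
  simp

/-- A colouring of the words of length `B` separating words confusable by a burst of at most `t`
deletions. -/
def IsBurstColoring {γ : Type*} (t B : ℕ) (c : (Fin B → Bool) → γ) : Prop :=
  ∀ f g s i j, s ≤ t → j + s ≤ B → BurstShift s i j (extendFalse f) (extendFalse g) →
    c f = c g → f = g

theorem exists_isBurstColoring {γ : Type*} [Fintype γ] (t B : ℕ)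
    (hγ : Fintype.card (BurstData t B) < Fintype.card γ) :
    ∃ c : (Fin B → Bool) → γ, IsBurstColoring t B c := by
  obtain ⟨c, hc⟩ := exists_coloring_of_card_lt
    (fun f g : Fin B → Bool =>
      ∃ s i j, s ≤ t ∧ j + s ≤ B ∧ BurstShift s i j (extendFalse f) (extendFalse g))
    (burstNeighbor (t := t) (B := B))
    (fun f g ⟨s, i, j, hs, hj, h⟩ => h.right_mem_range hs hj)
    (fun f g ⟨s, i, j, hs, hj, h⟩ => h.left_mem_range hs hj) hγ
  exact ⟨c, fun f g s i j hs hj h => hc f g ⟨s, i, j, hs, hj, h⟩⟩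

/-- The factor of length `B` of `x` at position `p`. -/
def factor (B p : ℕ) (x : ℕ → Bool) (k : Fin B) : Bool := x (p + k)

/-- The sum of the colours of the first `N` consecutive blocks of length `B` starting at `o`. -/
def blockSum {γ : Type*} [AddCommMonoid γ] {B : ℕ} (c : (Fin B → Bool) → γ) (o N : ℕ)
    (x : ℕ → Bool) : γ :=
  ∑ q ∈ Finset.range N, c (factor B (o + q * B) x)

namespace BurstShift

variable {t s i j : ℕ} {x y : ℕ → Bool}

theorem factor (h : BurstShift s i j x y) {B p : ℕ} (hp : p ≤ i) (hB : j + s ≤ p + B) :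
    BurstShift s (i - p) (j - p) (extendFalse (factor B p x)) (extendFalse (factor B p y)) where
  le := Nat.sub_le_sub_right h.le p
  left k hk := by
    have := h.le
    rw [extendFalse_of_lt _ (by omega), extendFalse_of_lt _ (by omega)]
    exact h.left (p + k) (by omega)
  mid k hk hk' := by
    rw [extendFalse_of_lt _ (by omega), extendFalse_of_lt _ (by omega)]
    simpa [_root_.factor, add_assoc] using h.mid (p + k) (by omega) (by omega)
  right k hk := by
    rcases lt_or_ge k B with hkB | hkB
    · rw [extendFalse_of_lt _ hkB, extendFalse_of_lt _ hkB]
      exact h.right (p + k) (by omega)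
    · rw [extendFalse_of_le _ hkB, extendFalse_of_le _ hkB]

theorem eq_of_blockSum_eq (h : BurstShift s i j x y) (hst : s ≤ t) {γ : Type*} [AddCommGroup γ]
    {B : ℕ} {c : (Fin B → Bool) → γ} (hc : IsBurstColoring t B c) {o q N : ℕ} (hqN : q < N)
    (hi : o + q * B ≤ i) (hj : j + s ≤ o + q * B + B)
    (hsum : blockSum c o N x = blockSum c o N y) : x = y := by
  have hq : q ∈ Finset.range N := Finset.mem_range.2 hqN
  unfold blockSum at hsum
  rw [← Finset.add_sum_erase _ _ hq, ← Finset.add_sum_erase _ _ hq] at hsum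
  have hrest : ∑ r ∈ (Finset.range N).erase q, c (_root_.factor B (o + r * B) x) =
      ∑ r ∈ (Finset.range N).erase q, c (_root_.factor B (o + r * B) y) := by
    refine Finset.sum_congr rfl fun r hr => congrArg c (funext fun k => ?_)
    have hk := k.2
    rcases lt_or_gt_of_ne (Finset.ne_of_mem_erase hr) with hr' | hr'
    · have : (r + 1) * B ≤ q * B := Nat.mul_le_mul_right _ hr'
      rw [add_mul, one_mul] at this
      exact h.left _ (by omega)
    · have : (q + 1) * B ≤ r * B := Nat.mul_le_mul_right _ hr'
      rw [add_mul, one_mul] at this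
      exact h.right _ (by omega)
  rw [hrest] at hsum
  have hle := h.le
  have heq := hc _ _ s _ _ hst (by omega) (h.factor hi hj) (add_right_cancel hsum)
  funext k
  rcases lt_or_ge k i with hk | hk
  · exact h.left k hk
  rcases lt_or_ge k (j + s) with hk' | hk'
  · have := congrFun heq ⟨k - (o + q * B), by omega⟩
    simpa [_root_.factor, show o + q * B + (k - (o + q * B)) = k by omega] using this
  · exact h.right k hk'

/-- Confusable words whose bursts are close together are separated by the block sums of two
tilings offset by half a block. -/
theorem eq_of_two_blockSum_eq (h : BurstShift s i j x y) (hst : s ≤ t) {γ : Type*}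
    [AddCommGroup γ] {H : ℕ} {c : (Fin (2 * H) → Bool) → γ} (hc : IsBurstColoring t (2 * H) c)
    {N : ℕ} (hH : 0 < H) (hiN : i < N) (hclose : j + s ≤ i + H)
    (h0 : blockSum c 0 N x = blockSum c 0 N y) (h1 : blockSum c H N x = blockSum c H N y) :
    x = y := by
  rcases le_or_gt (i % (2 * H)) H with hi | hi
  · have hdiv := Nat.div_add_mod' i (2 * H)
    refine h.eq_of_blockSum_eq hst hc (o := 0) (q := i / (2 * H)) ?_ ?_ ?_ h0
    · exact (Nat.div_le_self _ _).trans_lt hiN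
    · omega
    · omega
  · have hdiv := Nat.div_add_mod' i (2 * H)
    have hmod := Nat.mod_lt i (show 0 < 2 * H by omega)
    refine h.eq_of_blockSum_eq hst hc (o := H) (q := i / (2 * H)) ?_ ?_ ?_ h1
    · exact (Nat.div_le_self _ _).trans_lt hiN
    · omega
    · omega

end BurstShift

namespace BurstShift

theorem of_append_eq {α : Type*} {u v w u' v' w' : List α} (a : α) (hlen : v.length = v'.length)
    (hle : u.length ≤ u'.length) (hz : u ++ w = u' ++ w') :
    BurstShift v.length u.length u'.length (fun k => (u ++ v ++ w)[k]?.getD a)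
      (fun k => (u' ++ v' ++ w')[k]?.getD a) := by
  have hl : ∀ (u v w : List α) (k : ℕ), k < u.length → (u ++ v ++ w)[k]? = (u ++ w)[k]? := by
    intro u v w k hk
    rw [List.append_assoc, List.getElem?_append_left hk, List.getElem?_append_left hk]
  have hr : ∀ (u v w : List α) (k : ℕ), u.length ≤ k →
      (u ++ v ++ w)[k + v.length]? = (u ++ w)[k]? := by
    intro u v w k hk
    rw [List.getElem?_append_right (by simp; omega), List.getElem?_append_right hk]
    congr 1
    simp
    omega
  refine ⟨hle, fun k hk => ?_, fun k hk hk' => ?_, fun k hk => ?_⟩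
  · rw [hl u v w k hk, hl u' v' w' k (by omega), hz]
  · rw [hr u v w k hk, hl u' v' w' k hk', hz]
  · obtain ⟨m, rfl⟩ := Nat.exists_eq_add_of_le hk
    have h1 := hr u v w (u'.length + m) (by omega)
    have h2 := hr u' v' w' (u'.length + m) (by omega)
    rw [← hlen] at h2
    rw [show u'.length + v.length + m = u'.length + m + v.length by omega, h1, h2, hz]

theorem eq_of_zero {α : Type*} {i j : ℕ} {x y : ℕ → α} (h : BurstShift 0 i j x y) : x = y := by
  funext k
  rcases lt_or_ge k i with hk | hk
  · exact h.left k hk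
  rcases lt_or_ge k j with hk' | hk'
  · exact (h.mid k hk hk').symm
  · exact h.right k hk'

end BurstShift

theorem extendFalse_eq_getD {N : ℕ} (f : Fin N → Bool) :
    extendFalse f = fun k => (List.ofFn f)[k]?.getD false := by
  funext k
  unfold extendFalse
  split_ifs with h <;> simp [h]

theorem exists_burstShift_of_mem_inter {t N : ℕ} {f g : Fin N → Bool} {z : List Bool}
    (hf : z ∈ Bset t (List.ofFn f)) (hg : z ∈ Bset t (List.ofFn g)) :
    ∃ s i j, s ≤ t ∧ j + s ≤ N ∧ (BurstShift s i j (extendFalse f) (extendFalse g) ∨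
      BurstShift s i j (extendFalse g) (extendFalse f)) := by
  obtain ⟨u, v, w, hf, rfl, hv⟩ := hf
  obtain ⟨u', v', w', hg, hz, hv'⟩ := hg
  have h1 := congrArg List.length hf
  have h2 := congrArg List.length hg
  have h3 := congrArg List.length hz
  simp only [List.length_ofFn, List.length_append] at h1 h2 h3
  rw [extendFalse_eq_getD f, extendFalse_eq_getD g, hf, hg]
  rcases le_total u.length u'.length with hle | hle
  · exact ⟨v.length, u.length, u'.length, hv, by omega,
      Or.inl (BurstShift.of_append_eq false (by omega) hle hz)⟩
  · exact ⟨v'.length, u'.length, u.length, hv', by omega,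
      Or.inr (BurstShift.of_append_eq false (by omega) hle hz.symm)⟩

section Counting

/-- Overwrite the factor of length `t + 1` at position `p` by `1 0^t`. -/
def overwritePattern {N : ℕ} (t p : ℕ) (f : Fin N → Bool) (k : Fin N) : Bool :=
  if p ≤ k ∧ k ≤ p + t then decide ((k : ℕ) = p) else f k

theorem patternAt_overwritePattern {N t p : ℕ} (hp : p + t < N) (f : Fin N → Bool) :
    PatternAt t (extendFalse (overwritePattern t p f)) p := by
  refine ⟨?_, fun r hr => ?_⟩
  · rw [extendFalse_of_lt _ (by omega)]
    simp [overwritePattern]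
  · rw [extendFalse_of_lt _ (by omega)]
    simp only [overwritePattern]
    rw [if_pos (by omega)]
    exact decide_eq_false (by omega)

theorem patternAt_overwritePattern_iff {N t p k : ℕ} (hk : k + t < p) (hp : p + t < N)
    (f : Fin N → Bool) :
    PatternAt t (extendFalse (overwritePattern t p f)) k ↔ PatternAt t (extendFalse f) k := by
  have h : ∀ m < p, extendFalse (overwritePattern t p f) m = extendFalse f m := by
    intro m hm
    rw [extendFalse_of_lt _ (by omega), extendFalse_of_lt _ (by omega)]
    exact if_neg (fun h => by simp only at h; omega)
  unfold PatternAt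
  rw [h k (by omega)]
  exact and_congr_right fun _ => forall₂_congr fun r hr => by rw [h (k + 1 + r) (by omega)]

open Classical in
/-- Words of length `N` without `1 0^t` at the first `Q` aligned positions after `p`. -/
noncomputable def avoiding (t N p Q : ℕ) : Finset (Fin N → Bool) :=
  {f | ∀ r < Q, ¬ PatternAt t (extendFalse f) (p + r * (t + 1))}

theorem mem_avoiding {t N p Q : ℕ} {f : Fin N → Bool} : f ∈ avoiding t N p Q ↔
    ∀ r < Q, ¬ PatternAt t (extendFalse f) (p + r * (t + 1)) := by
  simp [avoiding]

theorem card_avoiding_le_mul (t N p Q : ℕ) (hN : p + (Q + 1) * (t + 1) ≤ N) :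
    (avoiding t N p Q).card ≤
      (avoiding t N p Q \ avoiding t N p (Q + 1)).card * 2 ^ (t + 1) := by
  classical
  have hN' : p + Q * (t + 1) + t < N := by
    rw [add_mul] at hN; omega
  have key : (avoiding t N p Q).card ≤ ((avoiding t N p Q \ avoiding t N p (Q + 1)) ×ˢ
      (Finset.univ : Finset (Fin (t + 1) → Bool))).card := by
    refine Finset.card_le_card_of_injOn
      (fun f => (overwritePattern t (p + Q * (t + 1)) f,
        fun r => extendFalse f (p + Q * (t + 1) + r))) (fun f hf => ?_) (fun f _ g _ hfg => ?_)
    · rw [Finset.mem_coe, mem_avoiding] at hf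
      simp only [Finset.coe_product, Set.mem_prod, Finset.mem_coe, Finset.mem_sdiff, mem_avoiding,
        Finset.mem_univ, and_true]
      refine ⟨fun r hr => ?_, fun h => ?_⟩
      · rw [patternAt_overwritePattern_iff _ hN']
        · exact hf r hr
        · have : (r + 1) * (t + 1) ≤ Q * (t + 1) := Nat.mul_le_mul_right _ hr
          rw [add_mul] at this
          omega
      · exact h Q (Nat.lt_succ_self Q) (patternAt_overwritePattern hN' f)
    · obtain ⟨h1, h2⟩ := Prod.mk.inj hfg
      funext k
      by_cases hk : p + Q * (t + 1) ≤ k ∧ k ≤ p + Q * (t + 1) + t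
      · have := congrFun h2 ⟨k - (p + Q * (t + 1)), by omega⟩
        simp only at this
        rwa [Nat.add_sub_cancel' hk.1, extendFalse_of_lt _ k.2, extendFalse_of_lt _ k.2] at this
      · have := congrFun h1 k
        simpa only [overwritePattern, if_neg hk] using this
  simpa using key

theorem card_avoiding_mul_le (t N p Q : ℕ) (hN : p + Q * (t + 1) ≤ N) :
    (avoiding t N p Q).card * (2 ^ (t + 1)) ^ Q ≤ 2 ^ N * (2 ^ (t + 1) - 1) ^ Q := by
  induction Q with
  | zero => simp [avoiding]
  | succ Q ih =>
    have ih := ih (le_trans (by gcongr; omega) hN)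
    have h1 := card_avoiding_le_mul t N p Q hN
    have hsub : avoiding t N p (Q + 1) ⊆ avoiding t N p Q := fun f hf =>
      mem_avoiding.2 fun r hr => mem_avoiding.1 hf r (by omega)
    have h2 := Finset.card_sdiff_add_card_eq_card hsub
    obtain ⟨b, hb⟩ : ∃ b, 2 ^ (t + 1) = b + 1 := ⟨2 ^ (t + 1) - 1, by
      have := Nat.one_le_two_pow (n := t + 1); omega⟩
    rw [hb] at h1 ih ⊢
    rw [Nat.add_sub_cancel] at ih ⊢
    have h3 : (avoiding t N p (Q + 1)).card * (b + 1) ≤ (avoiding t N p Q).card * b := by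
      nlinarith
    calc (avoiding t N p (Q + 1)).card * (b + 1) ^ (Q + 1)
        = (avoiding t N p (Q + 1)).card * (b + 1) * (b + 1) ^ Q := by ring
      _ ≤ (avoiding t N p Q).card * b * (b + 1) ^ Q := Nat.mul_le_mul_right _ h3
      _ = (avoiding t N p Q).card * (b + 1) ^ Q * b := by ring
      _ ≤ 2 ^ N * b ^ Q * b := Nat.mul_le_mul_right _ ih
      _ = 2 ^ N * b ^ (Q + 1) := by ring

theorem two_mul_pow_le_succ_pow (b : ℕ) : 2 * b ^ (b + 1) ≤ (b + 1) ^ (b + 1) := by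
  rcases Nat.eq_zero_or_pos b with rfl | hb
  · simp
  have h : ((b : ℝ) + 1) ^ (b + 1) = (b : ℝ) ^ (b + 1) * (1 + 1 / b) ^ (b + 1) := by
    rw [← mul_pow]
    congr 1
    field_simp
  have h2 := one_add_mul_le_pow (a := 1 / (b : ℝ)) (by
    have : 0 ≤ 1 / (b : ℝ) := by positivity
    linarith) (b + 1)
  have h3 : (2 : ℝ) ≤ 1 + ((b + 1 : ℕ) : ℝ) * (1 / b) := by
    have : ((b + 1 : ℕ) : ℝ) * (1 / b) = 1 + 1 / b := by
      push_cast
      field_simp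
    rw [this]
    have : 0 ≤ 1 / (b : ℝ) := by positivity
    linarith
  have : (2 * b ^ (b + 1) : ℝ) ≤ ((b : ℝ) + 1) ^ (b + 1) := by
    rw [h, mul_comm]
    exact mul_le_mul_of_nonneg_left (h3.trans h2) (by positivity)
  exact_mod_cast this

theorem card_avoiding_mul_two_pow_le (t N p l : ℕ)
    (hN : p + 2 ^ (t + 1) * l * (t + 1) ≤ N) :
    (avoiding t N p (2 ^ (t + 1) * l)).card * 2 ^ l ≤ 2 ^ N := by
  have h := card_avoiding_mul_le t N p _ hN
  obtain ⟨b, hb⟩ : ∃ b, 2 ^ (t + 1) = b + 1 := ⟨2 ^ (t + 1) - 1, by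
    have := Nat.one_le_two_pow (n := t + 1); omega⟩
  have hb0 : 0 < b := by
    have : 2 ^ 1 ≤ 2 ^ (t + 1) := Nat.pow_le_pow_right (by norm_num) (by omega)
    omega
  rw [hb] at h ⊢
  rw [Nat.add_sub_cancel] at h
  have h2 : 2 ^ l * b ^ ((b + 1) * l) ≤ (b + 1) ^ ((b + 1) * l) := by
    rw [pow_mul, pow_mul, ← mul_pow]
    exact Nat.pow_le_pow_left (two_mul_pow_le_succ_pow b) l
  refine Nat.le_of_mul_le_mul_right (c := b ^ ((b + 1) * l)) ?_ (by positivity)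
  calc (avoiding t N p ((b + 1) * l)).card * 2 ^ l * b ^ ((b + 1) * l)
      = (avoiding t N p ((b + 1) * l)).card * (2 ^ l * b ^ ((b + 1) * l)) := by ring
    _ ≤ (avoiding t N p ((b + 1) * l)).card * (b + 1) ^ ((b + 1) * l) :=
        Nat.mul_le_mul_left _ h2
    _ ≤ _ := h

/-- The window length for which most words are pattern-dense. -/
def windowLength (t l : ℕ) : ℕ := 2 ^ (t + 1) * l * (t + 1)

open Classical in
/-- The pattern-dense words of length `N`. -/
noncomputable def denseWords (t l N : ℕ) : Finset (Fin N → Bool) :=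
  {f | PatternDense t (windowLength t l) N (extendFalse f)}

theorem mem_denseWords {t l N : ℕ} {f : Fin N → Bool} : f ∈ denseWords t l N ↔
    PatternDense t (windowLength t l) N (extendFalse f) := by
  simp [denseWords]

theorem two_pow_le_two_mul_card_denseWords {t l N : ℕ} (ht : 1 ≤ t) (hl0 : 0 < l)
    (hl : 2 * N ≤ 2 ^ l) :
    2 ^ N ≤ 2 * (denseWords t l N).card := by
  classical
  have hw0 : 0 < windowLength t l := by unfold windowLength; positivity
  set w := windowLength t l with hw
  have hcover : (Finset.univ : Finset (Fin N → Bool)) ⊆ denseWords t l N ∪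
      ((Finset.range N).filter fun q => (q + 1) * w ≤ N).biUnion
        fun q => avoiding t N (q * w) (2 ^ (t + 1) * l) := by
    intro f _
    by_contra hf
    rw [Finset.mem_union, not_or, mem_denseWords] at hf
    refine hf.1 fun q hq => ?_
    rw [← hw] at hq
    by_contra hq'
    refine hf.2 (Finset.mem_biUnion.2 ⟨q, ?_, mem_avoiding.2 fun r hr hpat => hq' ?_⟩)
    · refine Finset.mem_filter.2 ⟨Finset.mem_range.2 ?_, hq⟩
      have := Nat.le_mul_of_pos_right (q + 1) hw0
      omega
    · refine ⟨q * w + r * (t + 1), Nat.le_add_right _ _, ?_, hpat⟩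
      have : (r + 1) * (t + 1) ≤ w := Nat.mul_le_mul_right _ hr
      rw [← hw, add_mul q 1 w]
      rw [add_mul] at this
      omega
  have h1 := (Finset.card_le_card hcover).trans (Finset.card_union_le _ _)
  simp only [Finset.card_univ, Fintype.card_fun, Fintype.card_bool, Fintype.card_fin] at h1
  set bad := (((Finset.range N).filter fun q => (q + 1) * w ≤ N).biUnion
        fun q => avoiding t N (q * w) (2 ^ (t + 1) * l)).card with hbad
  have h2 : bad * 2 ^ l ≤ N * 2 ^ N := by
    calc bad * 2 ^ l ≤ (∑ q ∈ (Finset.range N).filter fun q => (q + 1) * w ≤ N,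
          (avoiding t N (q * w) (2 ^ (t + 1) * l)).card) * 2 ^ l :=
          Nat.mul_le_mul_right _ Finset.card_biUnion_le
      _ = ∑ q ∈ (Finset.range N).filter fun q => (q + 1) * w ≤ N,
          (avoiding t N (q * w) (2 ^ (t + 1) * l)).card * 2 ^ l := Finset.sum_mul _ _ _
      _ ≤ ∑ q ∈ (Finset.range N).filter fun q => (q + 1) * w ≤ N, 2 ^ N := by
          refine Finset.sum_le_sum fun q hq => card_avoiding_mul_two_pow_le t N _ l ?_
          have := (Finset.mem_filter.1 hq).2
          rw [add_mul, one_mul] at this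
          exact this
      _ ≤ N * 2 ^ N := by
          rw [Finset.sum_const, smul_eq_mul]
          refine Nat.mul_le_mul_right _ ((Finset.card_filter_le _ _).trans ?_)
          simp
  have h3 : 2 * bad ≤ 2 ^ N := by
    refine Nat.le_of_mul_le_mul_right (c := 2 ^ l) ?_ (by positivity)
    calc 2 * bad * 2 ^ l = 2 * (bad * 2 ^ l) := by ring
      _ ≤ 2 * (N * 2 ^ N) := Nat.mul_le_mul_left _ h2
      _ = 2 ^ N * (2 * N) := by ring
      _ ≤ 2 ^ N * 2 ^ l := Nat.mul_le_mul_left _ hl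
  omega

end Counting

/-- Bound on the distance between the burst positions of confusable pattern-dense words. -/
def burstRadius (t l : ℕ) : ℕ := (3 * t * (3 * t + 1) + 4) * windowLength t l

theorem exists_burst_code {t l n N : ℕ} (ht : 1 ≤ t) (hl0 : 0 < l) (hl : 2 * N ≤ 2 ^ l)
    (hN : ((3 * t + 1) * N + 1) * ((3 * t + 2) *
      ((Fintype.card (BurstData t (2 * burstRadius t l)) + 1) *
        (Fintype.card (BurstData t (2 * burstRadius t l)) + 1))) * 2 ^ n * 2 ≤ 2 ^ N) :
    ∃ C : Finset (Fin N → Bool), 2 ^ n ≤ C.card ∧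
      ∀ f ∈ C, ∀ g ∈ C, f ≠ g → Bset t (List.ofFn f) ∩ Bset t (List.ofFn g) = ∅ := by
  classical
  set H := burstRadius t l with hH
  set m := Fintype.card (BurstData t (2 * H)) with hm
  set P := (3 * t + 1) * N + 1 with hP
  have hw : t ≤ windowLength t l := by
    unfold windowLength
    calc t ≤ t + 1 := Nat.le_succ t
      _ ≤ 2 ^ (t + 1) * l * (t + 1) := Nat.le_mul_of_pos_left _ (by positivity)
  have hH0 : 0 < H := Nat.mul_pos (by omega) (by omega)
  obtain ⟨c, hc⟩ := exists_isBurstColoring (γ := ZMod (m + 1)) t (2 * H) (by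
    rw [ZMod.card, ← hm]
    exact Nat.lt_succ_self m)
  let inv : (Fin N → Bool) → ZMod P × ZMod (3 * t + 2) × ZMod (m + 1) × ZMod (m + 1) := fun f =>
    (((∑ k ∈ Finset.range N, patternCount t (extendFalse f) k : ℤ) : ZMod P),
      ((patternCount t (extendFalse f) N : ℤ) : ZMod (3 * t + 2)),
      blockSum c 0 N (extendFalse f), blockSum c H N (extendFalse f))
  have hdense := two_pow_le_two_mul_card_denseWords ht hl0 hl
  obtain ⟨v, -, hv⟩ := Finset.exists_le_card_fiber_of_mul_le_card_of_maps_to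
    (s := denseWords t l N) (t := Finset.univ) (f := inv) (n := 2 ^ n)
    (fun _ _ => Finset.mem_univ _) ⟨0, Finset.mem_univ _⟩ (by
      rw [Finset.card_univ]
      simp only [Fintype.card_prod, ZMod.card]
      omega)
  have key : ∀ f ∈ denseWords t l N, ∀ g, inv f = inv g → ∀ s i j, s ≤ t → j + s ≤ N →
      BurstShift s i j (extendFalse f) (extendFalse g) → f = g := by
    intro f hf g hfg s i j hst hj h
    simp only [inv, Prod.mk.injEq] at hfg
    obtain ⟨h1, h2, h3, h4⟩ := hfg
    apply extendFalse_injective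
    rcases Nat.eq_zero_or_pos s with rfl | hs
    · exact h.eq_of_zero
    have hle := h.le
    refine h.eq_of_two_blockSum_eq hst hc hH0 (by omega) ?_ h3 h4
    refine h.sub_le hs hst hw (mem_denseWords.1 hf) hj (Nat.lt_succ_self _) ?_ ?_
    · exact (ZMod.intCast_eq_intCast_iff_dvd_sub _ _ _).1 h2.symm
    · exact (ZMod.intCast_eq_intCast_iff_dvd_sub _ _ _).1 h1.symm
  refine ⟨_, hv, fun f hf g hg hne => Set.eq_empty_iff_forall_notMem.2 fun z hz => hne ?_⟩
  rw [Finset.mem_filter] at hf hg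
  obtain ⟨s, i, j, hst, hj, h | h⟩ := exists_burstShift_of_mem_inter hz.1 hz.2
  · exact key f hf.1 g (hf.2.trans hg.2.symm) s i j hst hj h
  · exact (key g hg.1 f (hg.2.trans hf.2.symm) s i j hst hj h).symm

theorem exists_redundancy_constant (t : ℕ) : ∃ c : ℕ, 0 < c ∧ ∀ n N l : ℕ, 0 < n → 0 < l →
    N ≤ 2 * n →
    ((3 * t + 1) * N + 1) * ((3 * t + 2) *
      ((Fintype.card (BurstData t (2 * burstRadius t l)) + 1) *
        (Fintype.card (BurstData t (2 * burstRadius t l)) + 1))) ≤ c * (n * l ^ 4) := by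
  set h := (3 * t * (3 * t + 1) + 4) * (2 ^ (t + 1) * (t + 1)) with hh
  set b := (t + 1) * (2 * h + 1) ^ 2 * (2 * 2 ^ t) + 1 with hb
  refine ⟨(6 * t + 3) * ((3 * t + 2) * (b * b)), by positivity, fun n N l hn hl hN => ?_⟩
  have hrad : burstRadius t l = h * l := by
    rw [burstRadius, windowLength, hh]
    ring
  have hcard : Fintype.card (BurstData t (2 * burstRadius t l)) + 1 ≤ b * l ^ 2 := by
    rw [card_burstData, hrad]
    have h1 : 2 * (h * l) + 1 ≤ (2 * h + 1) * l := by nlinarith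
    have h2 : 1 ≤ l ^ 2 := Nat.one_le_pow _ _ hl
    calc (t + 1) * ((2 * (h * l) + 1) * ((2 * (h * l) + 1) * (2 * 2 ^ t))) + 1
        ≤ (t + 1) * (((2 * h + 1) * l) * (((2 * h + 1) * l) * (2 * 2 ^ t))) + l ^ 2 := by gcongr
      _ = b * l ^ 2 := by rw [hb]; ring
  have hP : (3 * t + 1) * N + 1 ≤ (6 * t + 3) * n := by nlinarith
  calc _ ≤ ((6 * t + 3) * n) * ((3 * t + 2) * ((b * l ^ 2) * (b * l ^ 2))) := by gcongr
    _ = _ := by ring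

theorem exists_forall_mul_log_pow_le_two_pow (c : ℕ) :
    ∃ n₀ : ℕ, ∀ n ≥ n₀, c * (n * (Nat.log 2 n + 3) ^ 4) ≤ 2 ^ n := by
  have h := (isLittleO_pow_const_const_pow_of_one_lt (R := ℝ) 5 one_lt_two).def
    (c := 1 / (256 * (c + 1))) (by positivity)
  obtain ⟨n₀, hn₀⟩ := Filter.eventually_atTop.1 h
  refine ⟨max n₀ 1, fun n hn => ?_⟩
  have h1 := hn₀ n (le_of_max_le_left hn)
  have hn1 : 1 ≤ n := le_of_max_le_right hn
  rw [Real.norm_of_nonneg (by positivity), Real.norm_of_nonneg (by positivity), div_mul_eq_mul_div,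
    one_mul, le_div_iff₀ (by positivity)] at h1
  have h2 : n ^ 5 * (256 * (c + 1)) ≤ 2 ^ n := by exact_mod_cast h1
  have h3 : Nat.log 2 n + 3 ≤ 4 * n := by
    have := Nat.log_le_self 2 n
    omega
  calc c * (n * (Nat.log 2 n + 3) ^ 4) ≤ (c + 1) * (n * (4 * n) ^ 4) := by gcongr; omega
    _ = n ^ 5 * (256 * (c + 1)) := by ring
    _ ≤ 2 ^ n := h2

theorem clog_two_le_logb_add_one (k : ℕ) :
    (Nat.clog 2 k : ℝ) ≤ Real.logb 2 k + 1 := by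
  have h := Real.ceil_logb_natCast (b := 2) (r := (k : ℝ)) (Nat.cast_nonneg k)
  rw [Int.clog_natCast] at h
  have h2 := Int.ceil_lt_add_one (Real.logb 2 k)
  have h3 : ((Nat.clog 2 k : ℤ) : ℝ) = Nat.clog 2 k := Int.cast_natCast _
  rw [← h3, ← h]
  exact h2.le

theorem logb_log_add_three_le {n : ℕ} (hn : 2 ≤ n) :
    Real.logb 2 (Nat.log 2 n + 3 : ℕ) ≤ 2 + Real.logb 2 (Real.logb 2 n) := by
  have h1 : (1 : ℝ) ≤ Real.logb 2 n := by
    rw [Real.le_logb_iff_rpow_le one_lt_two (by positivity)]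
    simpa using (by exact_mod_cast hn : (2 : ℝ) ≤ n)
  have h2 : (Nat.log 2 n : ℝ) ≤ Real.logb 2 n := Real.natLog_le_logb n 2
  have h4 : Real.logb 2 (4 : ℝ) = 2 := by
    rw [show (4 : ℝ) = 2 ^ (2 : ℝ) by norm_num]
    exact Real.logb_rpow (by norm_num) (by norm_num)
  calc Real.logb 2 (Nat.log 2 n + 3 : ℕ) ≤ Real.logb 2 (4 * Real.logb 2 n) := by
        refine Real.logb_le_logb_of_le one_lt_two (by positivity) ?_
        push_cast
        linarith
    _ = 2 + Real.logb 2 (Real.logb 2 n) := by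
        rw [Real.logb_mul (by norm_num) (by positivity), h4]

theorem stmt_3 (t : ℕ) (ht : 1 ≤ t) (ε : ℝ) (hε : 0 < ε) :
    ∃ γ : ℝ, ∃ n₀ : ℕ, ∀ n : ℕ, n₀ ≤ n →
      ∃ N : ℕ,
        ∃ E : {a : List Bool // a.length = n - 1} → {v : List Bool // v.length = N},
          Function.Injective E ∧
          (N : ℝ) - ((n : ℝ) - 1) ≤
            Real.logb 2 n + (9 + ε) * Real.logb 2 (Real.logb 2 n) + γ ∧
          ∀ a a' : {a : List Bool // a.length = n - 1}, a ≠ a' →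
            Bset t (E a).val ∩ Bset t (E a').val = ∅ := by
  obtain ⟨c, hc0, hc⟩ := exists_redundancy_constant t
  obtain ⟨n₀, hn₀⟩ := exists_forall_mul_log_pow_le_two_pow c
  refine ⟨Real.logb 2 c + 10, max n₀ 2, fun n hn => ?_⟩
  have hn2 : 2 ≤ n := le_of_max_le_right hn
  set l := Nat.log 2 n + 3 with hl
  set I := c * (n * l ^ 4) with hI
  have hI0 : 0 < I := by positivity
  have hclog : Nat.clog 2 I ≤ n := by
    rw [Nat.clog_le_iff_le_pow one_lt_two]
    exact hn₀ n (le_of_max_le_left hn)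
  obtain ⟨C, hcard, hC⟩ := exists_burst_code (t := t) (l := l) (n := n - 1)
    (N := n + Nat.clog 2 I) ht (by omega) (by
      have := Nat.lt_pow_succ_log_self one_lt_two n
      rw [hl, pow_succ, pow_succ]
      omega) (by
      refine (Nat.mul_le_mul_right _ (Nat.mul_le_mul_right _
        (hc n _ l (by omega) (by omega) (by omega)))).trans ?_
      rw [mul_assoc, ← pow_succ, Nat.sub_add_cancel (by omega), pow_add, mul_comm]
      exact Nat.mul_le_mul_left _ (Nat.le_pow_clog one_lt_two I))
  let _ : Fintype {a : List Bool // a.length = n - 1} :=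
    inferInstanceAs (Fintype (List.Vector Bool (n - 1)))
  have hdom : Fintype.card {a : List Bool // a.length = n - 1} = 2 ^ (n - 1) :=
    (card_vector (α := Bool) (n - 1)).trans (by simp)
  obtain ⟨φ, hφ⟩ := Function.Embedding.exists_of_card_le_finset (hdom.trans_le hcard)
  have hmem : ∀ a, φ a ∈ C := fun a => hφ ⟨a, rfl⟩
  refine ⟨n + Nat.clog 2 I, fun a => ⟨List.ofFn (φ a), List.length_ofFn⟩, fun a a' h => ?_, ?_,
    fun a a' hne => hC _ (hmem a) _ (hmem a') (φ.injective.ne hne)⟩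
  · exact φ.injective (List.ofFn_injective (congrArg Subtype.val h))
  · have h1 := clog_two_le_logb_add_one I
    have h2 : Real.logb 2 I = Real.logb 2 c + (Real.logb 2 n + 4 * Real.logb 2 l) := by
      have hc' : (c : ℝ) ≠ 0 := by positivity
      have hn' : (n : ℝ) ≠ 0 := by positivity
      have hl' : (l : ℝ) ≠ 0 := by positivity
      rw [hI]
      push_cast
      rw [Real.logb_mul hc' (by positivity), Real.logb_mul hn' (by positivity), Real.logb_pow]
      norm_num
    have h3 := logb_log_add_three_le hn2
    rw [← hl] at h3
    have h4 : 0 ≤ Real.logb 2 (Real.logb 2 n) := by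
      refine Real.logb_nonneg one_lt_two ?_
      rw [Real.le_logb_iff_rpow_le one_lt_two (by positivity)]
      simpa using (by exact_mod_cast hn2 : (2 : ℝ) ≤ n)
    have h5 : 0 ≤ (5 + ε) * Real.logb 2 (Real.logb 2 n) := by positivity
    push_cast
    nlinarith
end

section
/- Let q ≥ 2 be a fixed even integer and t ≥ 1 a fixed integer. For every real ε > 0 there exist a constant γ (depending only on t, q and ε) and an integer n₀ such that for all n ≥ n₀ there exist an integer N and an injective encoding map E : Z_q^{n−1} → Z_q^N such that (N − (n−1))·log₂ q ≤ log₂ n + (8·log₂ q + 9 + ε)·log₂ log₂ n + γ, and the code C = {E(u) : u ∈ Z_q^{n−1}} corrects a burst of at most t deletions, i.e., for all distinct u, u' ∈ Z_q^{n−1}, B_{≤t}(E(u)) ∩ B_{≤t}(E(u')) = ∅. -/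
namespace BurstCode

/-! ### Greedy colouring -/

theorem exists_proper_coloring {β : Type*} [DecidableEq β] (r : β → β → Prop)
    (hsymm : ∀ x y, r x y → r y x) (D : ℕ) (nb : β → Finset β)
    (hnb : ∀ x y, r x y → y ∈ nb x) (s : Finset β) (hcard : ∀ x ∈ s, (nb x).card ≤ D) :
    ∃ χ : β → ℕ, (∀ x, χ x < D + 1) ∧ ∀ x ∈ s, ∀ y ∈ s, x ≠ y → r x y → χ x ≠ χ y := by
  induction s using Finset.induction_on with
  | empty => exact ⟨fun _ => 0, by simp, by simp⟩
  | insert a s ha ih =>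
    obtain ⟨χ, hlt, hχ⟩ := ih fun x hx => hcard x (Finset.mem_insert_of_mem hx)
    obtain ⟨c, hc, hcn⟩ : ∃ c ∈ Finset.range (D + 1), c ∉ (nb a).image χ := by
      refine Finset.exists_mem_notMem_of_card_lt_card ?_
      have := hcard a (Finset.mem_insert_self a s)
      have := Finset.card_image_le (s := nb a) (f := χ)
      rw [Finset.card_range]
      omega
    have key : ∀ y, r a y → χ y ≠ c := fun y hy h =>
      hcn (Finset.mem_image.2 ⟨y, hnb a y hy, h⟩)
    refine ⟨Function.update χ a c, fun x => ?_, fun x hx y hy hxy hr => ?_⟩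
    · by_cases h : x = a
      · subst h; simpa using hc
      · simpa [Function.update_of_ne h] using hlt x
    · by_cases h : x = a
      · subst h
        rw [Function.update_self, Function.update_of_ne hxy.symm]
        exact (key y hr).symm
      · rw [Function.update_of_ne h]
        by_cases h' : y = a
        · subst h'
          rw [Function.update_self]
          exact key x (hsymm _ _ hr)
        · rw [Function.update_of_ne h']
          exact hχ x (Finset.mem_of_mem_insert_of_ne hx h) y
            (Finset.mem_of_mem_insert_of_ne hy h') hxy hr

/-! ### Moments of shifted indicator functions -/

theorem sum_Ico_weighted_bounds (f : ℕ → ℤ) (hf : ∀ j, 0 ≤ f j ∧ f j ≤ 1) (p r : ℕ) (z t : ℤ)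
    (hp : z - t ≤ p) (hr : (r : ℤ) ≤ z + t) :
    |∑ j ∈ Finset.Ico p r, (j : ℤ) * f j - z * ∑ j ∈ Finset.Ico p r, f j|
      ≤ t * ∑ j ∈ Finset.Ico p r, f j := by
  rw [Finset.mul_sum, Finset.mul_sum, ← Finset.sum_sub_distrib]
  refine (Finset.abs_sum_le_sum_abs _ _).trans (Finset.sum_le_sum fun j hj => ?_)
  rw [Finset.mem_Ico] at hj
  rw [← sub_mul, abs_mul, abs_of_nonneg (hf j).1]
  refine mul_le_mul_of_nonneg_right ?_ (hf j).1
  rw [abs_le]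
  omega

theorem sum_Ico_bounds (f : ℕ → ℤ) (hf : ∀ j, 0 ≤ f j ∧ f j ≤ 1) (p r : ℕ) :
    0 ≤ ∑ j ∈ Finset.Ico p r, f j ∧ ∑ j ∈ Finset.Ico p r, f j ≤ ((r - p : ℕ) : ℤ) := by
  refine ⟨Finset.sum_nonneg fun j _ => (hf j).1, ?_⟩
  refine (Finset.sum_le_card_nsmul _ _ 1 fun j _ => (hf j).2).trans ?_
  simp

theorem sum_Ico_le_of_spaced (f : ℕ → ℤ) (t : ℕ) (hf : ∀ j, f j = 0 ∨ f j = 1)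
    (hsp : ∀ i j, i < j → j ≤ i + t → f i = 1 → f j = 0) (p l : ℕ) :
    ((t : ℤ) + 1) * ∑ j ∈ Finset.Ico p (p + l), f j ≤ l + t := by
  induction l using Nat.strong_induction_on generalizing p with
  | _ l ih =>
    rcases Nat.eq_zero_or_pos l with rfl | hl
    · simp
    obtain ⟨l, rfl⟩ := Nat.exists_eq_succ_of_ne_zero hl.ne'
    rcases hf p with h | h
    · have := ih l (Nat.lt_succ_self l) (p + 1)
      rw [Finset.sum_eq_sum_Ico_succ_bot (by omega), h, zero_add,
        show p + l.succ = p + 1 + l by omega]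
      push_cast at *
      omega
    · rw [Finset.sum_eq_sum_Ico_succ_bot (by omega), h]
      rcases le_or_gt l t with hlt | hlt
      · rw [Finset.sum_eq_zero]
        · push_cast; omega
        · intro j hj
          rw [Finset.mem_Ico] at hj
          exact hsp p j (by omega) (by omega) h
      · have := ih (l - t) (by omega) (p + 1 + t)
        rw [← Finset.sum_Ico_consecutive f (show p + 1 ≤ p + 1 + t by omega) (by omega),
          Finset.sum_eq_zero, zero_add, show p + l.succ = p + 1 + t + (l - t) by omega]
        · rw [Nat.cast_sub hlt.le] at this
          push_cast
          linarith
        · intro j hj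
          rw [Finset.mem_Ico] at hj
          exact hsp p j (by omega) (by omega) h

theorem le_sum_Ico_of_dense (f : ℕ → ℤ) (hf : ∀ j, 0 ≤ f j) (δ N : ℕ)
    (hd : ∀ p, p + δ ≤ N → ∃ j, p ≤ j ∧ j < p + δ ∧ f j = 1) (p R : ℕ) (h : p + R * δ ≤ N) :
    (R : ℤ) ≤ ∑ j ∈ Finset.Ico p (p + R * δ), f j := by
  induction R with
  | zero => simp
  | succ R ih =>
    rw [Nat.succ_mul] at h ⊢
    rw [← Finset.sum_Ico_consecutive f (show p ≤ p + R * δ by omega) (by omega)]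
    obtain ⟨j, h1, h2, h3⟩ := hd (p + R * δ) (by omega)
    have := Finset.single_le_sum (f := f) (s := Finset.Ico (p + R * δ) (p + (R * δ + δ)))
      (fun i _ => hf i) (a := j) (Finset.mem_Ico.2 (by omega))
    have := ih (by omega)
    push_cast
    omega

theorem sum_range_split_four (f : ℕ → ℤ) {a b c d N : ℕ} (h1 : a ≤ b) (h2 : b ≤ c) (h3 : c ≤ d)
    (h4 : d ≤ N) :
    ∑ j ∈ Finset.range N, f j = ∑ j ∈ Finset.range a, f j + ∑ j ∈ Finset.Ico a b, f j
      + ∑ j ∈ Finset.Ico b c, f j + ∑ j ∈ Finset.Ico c d, f j + ∑ j ∈ Finset.Ico d N, f j := by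
  simp only [Finset.range_eq_Ico]
  rw [Finset.sum_Ico_consecutive f (Nat.zero_le _) h1,
    Finset.sum_Ico_consecutive f (Nat.zero_le _) h2,
    Finset.sum_Ico_consecutive f (Nat.zero_le _) h3,
    Finset.sum_Ico_consecutive f (Nat.zero_le _) h4]

/-- The arithmetic behind `moments_ne_of_shift`: `k` counts the shifted points, the capital letters
count the points in the boundary windows and the `m`s are their first moments. -/
theorem moments_arith (t s a m N k Hf Tf Hg Tg mHf mTf mHg mTg : ℤ) (hs : 1 ≤ s) (hst : s ≤ t)
    (hN : m ≤ N)
    (kU : (t + 1) * k ≤ m) (kL : 6 * t ^ 2 + 1 ≤ k)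
    (bHf : 0 ≤ Hf ∧ Hf ≤ 2 * t) (bTf : 0 ≤ Tf ∧ Tf ≤ t)
    (bHg : 0 ≤ Hg ∧ Hg ≤ t) (bTg : 0 ≤ Tg ∧ Tg ≤ 2 * t)
    (wHf : |mHf - a * Hf| ≤ t * Hf) (wTf : |mTf - (a + m) * Tf| ≤ t * Tf)
    (wHg : |mHg - a * Hg| ≤ t * Hg) (wTg : |mTg - (a + m) * Tg| ≤ t * Tg)
    (d0 : 6 * t + 1 ∣ Hf + Tf - (Hg + Tg))
    (d1 : 9 * t ^ 2 * N + 1 ∣ s * k + (mHf + mTf - mHg - mTg)) : False := by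
  have e0 : Hf + Tf = Hg + Tg := by
    have := Int.eq_zero_of_abs_lt_dvd d0 (by rw [abs_lt]; omega)
    omega
  obtain ⟨c, hc⟩ : ∃ c, c = Hf - Hg := ⟨_, rfl⟩
  obtain rfl : Hf = Hg + c := by omega
  obtain rfl : Tg = Tf + c := by omega
  have hcb : -(2 * t : ℤ) ≤ c ∧ c ≤ 2 * t := by omega
  have tpos : 1 ≤ t := by omega
  have kpos : 1 ≤ k := by linarith [sq_nonneg t]
  have hmpos : 1 ≤ m := by linarith [mul_nonneg (by omega : 0 ≤ t) (by omega : 0 ≤ k)]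
  have tHf : t * (Hg + c) ≤ t * (2 * t) := mul_le_mul_of_nonneg_left (by omega) (by omega)
  have tTf : t * Tf ≤ t * t := mul_le_mul_of_nonneg_left (by omega) (by omega)
  have tHg : t * Hg ≤ t * t := mul_le_mul_of_nonneg_left (by omega) (by omega)
  have tTg : t * (Tf + c) ≤ t * (2 * t) := mul_le_mul_of_nonneg_left (by omega) (by omega)
  obtain ⟨err, hE⟩ : ∃ err : ℤ, mHf + mTf - mHg - mTg = err - c * m :=
    ⟨mHf + mTf - mHg - mTg + c * m, by ring⟩
  rw [abs_le] at wHf wTf wHg wTg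
  have herr : |err| ≤ 6 * t ^ 2 := by
    rw [abs_le]
    constructor <;> linarith
  rw [abs_le] at herr
  have d1' : 9 * t ^ 2 * N + 1 ∣ s * k + err - c * m := by
    convert d1 using 1
    linarith
  have sk : s * k ≤ t * k := mul_le_mul_of_nonneg_right (by omega) (by omega)
  have kk : k ≤ s * k := le_mul_of_one_le_left (by omega) (by omega)
  have tk : t * k ≤ m := by linarith
  have hmt : t ^ 2 ≤ t ^ 2 * N := le_mul_of_one_le_right (by positivity) (by omega)
  have htN : t * N ≤ t ^ 2 * N := mul_le_mul_of_nonneg_right (by linarith [mul_nonneg (by omega : 0 ≤ t) (by omega : 0 ≤ t - 1)]) (by omega)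
  have cm : |c * m| ≤ 2 * (t * N) := by
    rw [abs_mul, abs_of_nonneg (by omega : 0 ≤ m), ← mul_assoc]
    exact mul_le_mul (abs_le.2 (by omega)) hN (by omega) (by omega)
  rw [abs_le] at cm
  have tN1 : N ≤ t * N := le_mul_of_one_le_left (by omega) tpos
  have e1 : s * k + err - c * m = 0 := by
    refine Int.eq_zero_of_abs_lt_dvd d1' ?_
    rw [abs_lt]
    constructor <;> linarith
  rcases lt_trichotomy c 0 with hc0 | rfl | hc0
  · have : c * m ≤ -1 * m := mul_le_mul_of_nonneg_right (by omega) (by omega)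
    linarith
  · linarith
  · have : m ≤ c * m := le_mul_of_one_le_left (by omega) (by omega)
    linarith

/-- If `g` arises from `f` by shifting a long interval by `s ≤ t` places (up to boundary effects of
width `t`), then the zeroth and first moments distinguish `f` from `g`. -/
theorem moments_ne_of_shift (f g : ℕ → ℤ) (t s a m N δ : ℕ)
    (hf : ∀ j, f j = 0 ∨ f j = 1) (hg : ∀ j, g j = 0 ∨ g j = 1)
    (hs : 1 ≤ s) (hst : s ≤ t) (hN : a + s + m ≤ N)
    (hm : t + (6 * t ^ 2 + 1) * δ ≤ m)
    (hsp : ∀ i j, i < j → j ≤ i + t → f i = 1 → f j = 0)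
    (hd : ∀ p, p + δ ≤ N → ∃ j, p ≤ j ∧ j < p + δ ∧ f j = 1)
    (hleft : ∀ j, j + t < a → f j = g j) (hright : ∀ j, a + s + m ≤ j → f j = g j)
    (hmid : ∀ j, a ≤ j → j + t < a + m → f (j + s) = g j)
    (h0 : ∑ j ∈ Finset.range N, f j ≡ ∑ j ∈ Finset.range N, g j [ZMOD (6 * t + 1 : ℕ)])
    (h1 : ∑ j ∈ Finset.range N, (j : ℤ) * f j ≡
      ∑ j ∈ Finset.range N, (j : ℤ) * g j [ZMOD (9 * t ^ 2 * N + 1 : ℕ)]) : False := by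
  have hf' : ∀ j, 0 ≤ f j ∧ f j ≤ 1 := fun j => by rcases hf j with h | h <;> omega
  have hg' : ∀ j, 0 ≤ g j ∧ g j ≤ 1 := fun j => by rcases hg j with h | h <;> omega
  have htm : t + δ ≤ m := by nlinarith [Nat.zero_le (t ^ 2 * δ)]
  have shift : ∀ φ : ℕ → ℤ, ∑ j ∈ Finset.Ico (a + s) (a + s + (m - t)), φ j =
      ∑ j ∈ Finset.Ico a (a + (m - t)), φ (j + s) := by
    intro φ
    rw [Finset.sum_Ico_add', show a + s + (m - t) = a + (m - t) + s by omega]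
  have cong : ∀ φ : ℕ → ℤ → ℤ, ∀ u v : ℕ, (∀ j, u ≤ j → j < v → f j = g j) →
      ∑ j ∈ Finset.Ico u v, φ j (f j) = ∑ j ∈ Finset.Ico u v, φ j (g j) := by
    intro φ u v h
    refine Finset.sum_congr rfl fun j hj => ?_
    rw [Finset.mem_Ico] at hj
    rw [h j hj.1 hj.2]
  have eL := cong (fun _ z => z) 0 (a - t) (fun j _ hj => hleft j (by omega))
  have eR := cong (fun _ z => z) (a + s + m) N (fun j hj _ => hright j hj)
  have eL' := cong (fun j z => (j : ℤ) * z) 0 (a - t) (fun j _ hj => hleft j (by omega))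
  have eR' := cong (fun j z => (j : ℤ) * z) (a + s + m) N (fun j hj _ => hright j hj)
  have eM : ∑ j ∈ Finset.Ico (a + s) (a + s + (m - t)), f j =
      ∑ j ∈ Finset.Ico a (a + (m - t)), g j := by
    rw [shift]
    refine Finset.sum_congr rfl fun j hj => ?_
    rw [Finset.mem_Ico] at hj
    exact hmid j hj.1 (by omega)
  have eM' : ∑ j ∈ Finset.Ico (a + s) (a + s + (m - t)), (j : ℤ) * f j =
      ∑ j ∈ Finset.Ico a (a + (m - t)), (j : ℤ) * g j +
        s * ∑ j ∈ Finset.Ico (a + s) (a + s + (m - t)), f j := by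
    rw [eM, shift fun j => (j : ℤ) * f j, Finset.mul_sum, ← Finset.sum_add_distrib]
    refine Finset.sum_congr rfl fun j hj => ?_
    rw [Finset.mem_Ico] at hj
    rw [hmid j hj.1 (by omega)]
    push_cast
    ring
  have o1 : a - t ≤ a + s := by omega
  have o2 : a + s ≤ a + s + (m - t) := by omega
  have o3 : a + s + (m - t) ≤ a + s + m := by omega
  have o1' : a - t ≤ a := by omega
  have o2' : a ≤ a + (m - t) := by omega
  have o3' : a + (m - t) ≤ a + s + m := by omega
  have kU := sum_Ico_le_of_spaced f t hf hsp (a + s) (m - t)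
  have kL := le_sum_Ico_of_dense f (fun j => (hf' j).1) δ N hd (a + s) (6 * t ^ 2 + 1) (by omega)
  have kL' : ∑ j ∈ Finset.Ico (a + s) (a + s + (6 * t ^ 2 + 1) * δ), f j ≤
      ∑ j ∈ Finset.Ico (a + s) (a + s + (m - t)), f j := by
    refine Finset.sum_le_sum_of_subset_of_nonneg (Finset.Ico_subset_Ico le_rfl (by omega)) ?_
    exact fun j _ _ => (hf' j).1
  replace kL := kL.trans kL'
  clear kL'
  have bHf := sum_Ico_bounds f hf' (a - t) (a + s)
  have bTf := sum_Ico_bounds f hf' (a + s + (m - t)) (a + s + m)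
  have bHg := sum_Ico_bounds g hg' (a - t) a
  have bTg := sum_Ico_bounds g hg' (a + (m - t)) (a + s + m)
  have wHf := sum_Ico_weighted_bounds f hf' (a - t) (a + s) a t (by omega) (by omega)
  have wTf := sum_Ico_weighted_bounds f hf' (a + s + (m - t)) (a + s + m) (a + m) t
    (by omega) (by omega)
  have wHg := sum_Ico_weighted_bounds g hg' (a - t) a a t (by omega) (by omega)
  have wTg := sum_Ico_weighted_bounds g hg' (a + (m - t)) (a + s + m) (a + m) t
    (by omega) (by omega)
  rw [← Finset.range_eq_Ico] at eL eL'
  rw [sum_range_split_four f o1 o2 o3 hN, sum_range_split_four g o1' o2' o3' hN, eL, eR, eM] at h0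
  rw [sum_range_split_four (fun j => (j : ℤ) * f j) o1 o2 o3 hN,
    sum_range_split_four (fun j => (j : ℤ) * g j) o1' o2' o3' hN, eL', eR', eM'] at h1
  rw [← eM] at h0
  generalize ∑ j ∈ Finset.Ico (a + s) (a + s + (m - t)), f j = k at *
  generalize ∑ j ∈ Finset.Ico (a - t) (a + s), f j = Hf at *
  generalize ∑ j ∈ Finset.Ico (a + s + (m - t)) (a + s + m), f j = Tf at *
  generalize ∑ j ∈ Finset.Ico (a - t) a, g j = Hg at *
  generalize ∑ j ∈ Finset.Ico (a + (m - t)) (a + s + m), g j = Tg at *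
  generalize ∑ j ∈ Finset.Ico (a - t) (a + s), (j : ℤ) * f j = mHf at *
  generalize ∑ j ∈ Finset.Ico (a + s + (m - t)) (a + s + m), (j : ℤ) * f j = mTf at *
  generalize ∑ j ∈ Finset.Ico (a - t) a, (j : ℤ) * g j = mHg at *
  generalize ∑ j ∈ Finset.Ico (a + (m - t)) (a + s + m), (j : ℤ) * g j = mTg at *
  have d0 := Int.modEq_iff_dvd.1 h0.symm
  have d1 := Int.modEq_iff_dvd.1 h1.symm
  refine moments_arith t s a m N k Hf Tf Hg Tg mHf mTf mHg mTg (by omega) (by omega)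
    (by omega) ?_ (by exact_mod_cast kL) (by omega) (by omega) (by omega) (by omega)
    wHf wTf wHg wTg ?_ ?_
  · rwa [Nat.cast_sub (by omega), sub_add_cancel] at kU
  · push_cast at d0
    convert d0 using 1
    ring
  · push_cast at d1
    convert d1 using 1
    ring

/-! ### Locating a burst with marks -/

section Strings

variable {α : Type*}

/-- The pattern consisting of `t` copies of `z` followed by `o` starts at position `j` of `x`. -/
def IsMark (z o : α) (t : ℕ) (x : List α) (j : ℕ) : Prop :=
  (∀ k < t, x[j + k]? = some z) ∧ x[j + t]? = some o

/-- Every window of length `δ` contains the start of a mark. -/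
def IsDense (z o : α) (t δ : ℕ) (x : List α) : Prop :=
  ∀ p, p + δ ≤ x.length → ∃ j, p ≤ j ∧ j < p + δ ∧ IsMark z o t x j

open Classical in
/-- The indicator function of the marks of `x`. -/
noncomputable def markInd (z o : α) (t : ℕ) (x : List α) (j : ℕ) : ℤ :=
  if IsMark z o t x j then 1 else 0

/-- The number of marks. -/
noncomputable def markCount (z o : α) (t : ℕ) (x : List α) : ℤ :=
  ∑ j ∈ Finset.range x.length, markInd z o t x j

/-- The sum of the positions of the marks. -/
noncomputable def markSum (z o : α) (t : ℕ) (x : List α) : ℤ :=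
  ∑ j ∈ Finset.range x.length, (j : ℤ) * markInd z o t x j

theorem markInd_eq_one {z o : α} {t : ℕ} {x : List α} {j : ℕ} :
    markInd z o t x j = 1 ↔ IsMark z o t x j := by
  unfold markInd; split_ifs <;> simp_all

theorem markInd_eq_zero {z o : α} {t : ℕ} {x : List α} {j : ℕ} :
    markInd z o t x j = 0 ↔ ¬ IsMark z o t x j := by
  unfold markInd; split_ifs <;> simp_all

theorem markInd_congr {z o : α} {t : ℕ} {x y : List α} {i j : ℕ}
    (h : ∀ k ≤ t, x[i + k]? = y[j + k]?) : markInd z o t x i = markInd z o t y j := by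
  have : IsMark z o t x i ↔ IsMark z o t y j := by
    unfold IsMark
    rw [h t le_rfl]
    refine and_congr_left fun _ => forall₂_congr fun k hk => ?_
    rw [h k hk.le]
  by_cases hy : IsMark z o t y j
  · rw [markInd_eq_one.2 hy, markInd_eq_one.2 (this.2 hy)]
  · rw [markInd_eq_zero.2 hy, markInd_eq_zero.2 (mt this.1 hy)]

theorem length_lt_of_shift {z o : α} (hzo : z ≠ o) (t δ : ℕ) (u v v' m w : List α)
    (hv : v.length = v'.length) (hv1 : 1 ≤ v.length) (hvt : v.length ≤ t)
    (hd : IsDense z o t δ (u ++ v ++ m ++ w))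
    (h0 : markCount z o t (u ++ v ++ m ++ w) ≡ markCount z o t (u ++ m ++ v' ++ w)
      [ZMOD (6 * t + 1 : ℕ)])
    (h1 : markSum z o t (u ++ v ++ m ++ w) ≡ markSum z o t (u ++ m ++ v' ++ w)
      [ZMOD (9 * t ^ 2 * (u ++ v ++ m ++ w).length + 1 : ℕ)]) :
    m.length < t + (6 * t ^ 2 + 1) * δ := by
  by_contra! hm
  have hlen : (u ++ m ++ v' ++ w).length = (u ++ v ++ m ++ w).length := by
    simp only [List.length_append]; omega
  unfold markCount markSum at *
  rw [hlen] at h0 h1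
  refine moments_ne_of_shift _ _ t v.length u.length m.length _ δ (fun j => ?_) (fun j => ?_)
    hv1 hvt ?_ hm (fun i j hij hjt hi => ?_) (fun p hp => ?_) (fun j hj => ?_) (fun j hj => ?_)
    (fun j hj hj' => ?_) h0 h1
  · unfold markInd; split_ifs <;> simp
  · unfold markInd; split_ifs <;> simp
  · simp only [List.length_append]; omega
  · rw [markInd_eq_one] at hi
    rw [markInd_eq_zero]
    intro hj
    have e1 := hj.1 (i + t - j) (by omega)
    rw [show j + (i + t - j) = i + t by omega, hi.2] at e1
    exact hzo (Option.some.inj e1).symm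
  · simpa only [markInd_eq_one] using hd p hp
  · refine markInd_congr fun k hk => ?_
    simp only [List.append_assoc]
    rw [List.getElem?_append_left (by omega), List.getElem?_append_left (by omega)]
  · refine markInd_congr fun k hk => ?_
    rw [List.getElem?_append_right (by simp only [List.length_append]; omega),
      List.getElem?_append_right (by simp only [List.length_append]; omega)]
    congr 1
    simp only [List.length_append]; omega
  · refine markInd_congr fun k hk => ?_
    rw [show u ++ m ++ v' ++ w = u ++ (m ++ (v' ++ w)) by simp, List.append_assoc (u ++ v),
      List.getElem?_append_right (l₁ := u ++ v) (by simp only [List.length_append]; omega),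
      List.getElem?_append_right (l₁ := u) (by omega),
      List.getElem?_append_left (by simp only [List.length_append]; omega),
      List.getElem?_append_left (by omega)]
    congr 1
    simp only [List.length_append]; omega

/-! ### Window syndromes -/

/-- `X` and `Y` have equal length and a common string in their burst deletion balls. -/
def Confusable (t : ℕ) (X Y : List α) : Prop :=
  X.length = Y.length ∧ ∃ z, z ∈ Bset t X ∧ z ∈ Bset t Y

theorem Confusable.symm {t : ℕ} {X Y : List α} (h : Confusable t X Y) : Confusable t Y X :=
  ⟨h.1.symm, h.2.imp fun _ hz => hz.symm⟩

theorem confusable_of_shift {t : ℕ} (u v v' m w : List α) (hv : v.length = v'.length)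
    (hvt : v.length ≤ t) : Confusable t (u ++ v ++ m ++ w) (u ++ m ++ v' ++ w) := by
  refine ⟨by simp only [List.length_append]; omega, u ++ m ++ w,
    ⟨u, v, m ++ w, by simp, by simp, hvt⟩, ⟨u ++ m, v', w, by simp, by simp, by omega⟩⟩

/-- Confusable strings differ by moving a substring across a short one. -/
theorem Confusable.exists_shift {t : ℕ} {x y : List α} (h : Confusable t x y) :
    ∃ u v v' m w : List α, v.length = v'.length ∧ v.length ≤ t ∧
      ((x = u ++ v ++ m ++ w ∧ y = u ++ m ++ v' ++ w) ∨
        (y = u ++ v ++ m ++ w ∧ x = u ++ m ++ v' ++ w)) := by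
  obtain ⟨hl, z, ⟨u, v, w, rfl, rfl, hv⟩, ⟨u', v', w', rfl, e, hv'⟩⟩ := h
  have hvv : v.length = v'.length := by
    have := congrArg List.length e
    simp only [List.length_append] at *
    omega
  rcases List.append_eq_append_iff.1 e with ⟨m, rfl, rfl⟩ | ⟨m, rfl, rfl⟩
  · exact ⟨u, v, v', m, w', hvv, hv, Or.inl ⟨by simp, by simp⟩⟩
  · exact ⟨u', v', v, m, w, hvv.symm, hv', Or.inr ⟨by simp, by simp⟩⟩

/-- The `k`-th window of length `2 * L`; consecutive windows overlap in `L` symbols. -/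
def window (L k : ℕ) (x : List α) : List α := (x.drop (k * L)).take (2 * L)

/-- Sum of the colours of the windows whose index has parity `b`. -/
def syndrome (χ : List α → ℕ) (L b : ℕ) (x : List α) : ℕ :=
  ∑ k ∈ (Finset.range (x.length + 1)).filter (· % 2 = b), χ (window L k x)

theorem getElem?_window (L k : ℕ) (x : List α) (j : ℕ) :
    (window L k x)[j]? = if j < 2 * L then x[k * L + j]? else none := by
  simp [window, List.getElem?_take]

theorem length_window_le (L k : ℕ) (x : List α) : (window L k x).length ≤ 2 * L := by
  simp [window]

theorem eq_of_syndrome_eq (t L D : ℕ) (χ : List α → ℕ) (hχ : ∀ x, χ x < D + 1)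
    (hL : 0 < L)
    (hproper : ∀ X Y : List α, X.length ≤ 2 * L → Y.length ≤ 2 * L → X ≠ Y → Confusable t X Y →
      χ X ≠ χ Y)
    (u v v' m w : List α) (hv : v.length = v'.length) (hvt : v.length ≤ t)
    (hvm : v.length + m.length ≤ L)
    (hs : ∀ b < 2, syndrome χ L b (u ++ v ++ m ++ w) ≡ syndrome χ L b (u ++ m ++ v' ++ w)
      [MOD D + 1]) : u ++ v ++ m ++ w = u ++ m ++ v' ++ w := by
  have hlen : (u ++ m ++ v' ++ w).length = (u ++ v ++ m ++ w).length := by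
    simp only [List.length_append]; omega
  have hout : ∀ p, p < u.length ∨ u.length + v.length + m.length ≤ p →
      (u ++ v ++ m ++ w)[p]? = (u ++ m ++ v' ++ w)[p]? := by
    rintro p (hp | hp)
    · simp only [List.append_assoc]
      rw [List.getElem?_append_left hp, List.getElem?_append_left hp]
    · rw [List.getElem?_append_right (by simp only [List.length_append]; omega),
        List.getElem?_append_right (by simp only [List.length_append]; omega)]
      congr 1
      simp only [List.length_append]; omega
  have hkL : u.length / L * L ≤ u.length := Nat.div_mul_le_self _ _
  have hkL' : u.length < (u.length / L + 1) * L := by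
    rw [add_mul, one_mul]; exact Nat.lt_div_mul_add hL
  have hkle : u.length / L ≤ u.length := Nat.div_le_self _ _
  generalize u.length / L = k at *
  have hconf : Confusable t (window L k (u ++ v ++ m ++ w)) (window L k (u ++ m ++ v' ++ w)) := by
    have e1 : window L k (u ++ v ++ m ++ w) = u.drop (k * L) ++ v ++ m ++
        w.take (2 * L - (u.length - k * L + v.length + m.length)) := by
      have : (u ++ v ++ m ++ w).drop (k * L) = u.drop (k * L) ++ v ++ m ++ w := by
        simp only [List.append_assoc]
        rw [List.drop_append_of_le_length hkL]
      rw [window, this, List.take_append, List.take_of_length_le]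
      · simp [add_assoc]
      · simp only [List.length_append, List.length_drop]
        rw [add_mul, one_mul] at hkL'
        omega
    have e2 : window L k (u ++ m ++ v' ++ w) = u.drop (k * L) ++ m ++ v' ++
        w.take (2 * L - (u.length - k * L + v.length + m.length)) := by
      have : (u ++ m ++ v' ++ w).drop (k * L) = u.drop (k * L) ++ m ++ v' ++ w := by
        simp only [List.append_assoc]
        rw [List.drop_append_of_le_length hkL]
      rw [window, this, List.take_append, List.take_of_length_le]
      · simp [add_assoc, hv, add_comm]
      · simp only [List.length_append, List.length_drop]
        rw [add_mul, one_mul] at hkL'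
        omega
    rw [e1, e2]
    exact confusable_of_shift _ _ _ _ _ hv hvt
  have hother : ∀ j, j % 2 = k % 2 → j ≠ k →
      window L j (u ++ v ++ m ++ w) = window L j (u ++ m ++ v' ++ w) := by
    intro j hj hjk
    refine List.ext_getElem? fun i => ?_
    rw [getElem?_window, getElem?_window]
    split_ifs with hi
    · refine hout _ ?_
      rw [add_mul, one_mul] at hkL'
      rcases lt_or_gt_of_ne hjk with h | h
      · left
        have : (j + 2) * L ≤ k * L := Nat.mul_le_mul_right _ (by omega)
        rw [add_mul] at this
        omega
      · right
        have : (k + 2) * L ≤ j * L := Nat.mul_le_mul_right _ (by omega)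
        rw [add_mul] at this
        omega
    · rfl
  have hmem : k ∈ (Finset.range ((u ++ v ++ m ++ w).length + 1)).filter (· % 2 = k % 2) := by
    simp only [Finset.mem_filter, Finset.mem_range, List.length_append, and_true]
    omega
  have hcol := hs (k % 2) (Nat.mod_lt _ two_pos)
  unfold syndrome at hcol
  rw [hlen, ← Finset.add_sum_erase _ _ hmem, ← Finset.add_sum_erase _ _ hmem,
    Finset.sum_congr rfl fun j hj => congrArg χ (hother j (Finset.mem_filter.1
      (Finset.mem_of_mem_erase hj)).2 (Finset.ne_of_mem_erase hj))] at hcol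
  have hwin : window L k (u ++ v ++ m ++ w) = window L k (u ++ m ++ v' ++ w) := by
    by_contra hne
    exact hproper _ _ (length_window_le _ _ _) (length_window_le _ _ _) hne hconf
      (Nat.ModEq.eq_of_lt_of_lt (Nat.ModEq.add_right_cancel' _ hcol) (hχ _) (hχ _))
  refine List.ext_getElem? fun p => ?_
  by_cases hp : p < u.length ∨ u.length + v.length + m.length ≤ p
  · exact hout p hp
  · rw [add_mul, one_mul] at hkL'
    have := congrArg (·[p - k * L]?) hwin
    simp only [getElem?_window] at this
    rwa [if_pos (by omega), if_pos (by omega), show k * L + (p - k * L) = p by omega] at this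

end Strings

/-! ### Counting strings -/

section Counting

variable {α : Type*} {z o : α} {t : ℕ}

theorem IsMark.append {l : List α} {j : ℕ} (h : IsMark z o t l j) (a b : List α) :
    IsMark z o t (a ++ l ++ b) (a.length + j) := by
  have hj : j + t < l.length := (List.getElem?_eq_some_iff.1 h.2).1
  have key : ∀ k ≤ t, (a ++ l ++ b)[a.length + j + k]? = l[j + k]? := by
    intro k hk
    rw [List.append_assoc, List.getElem?_append_right (by omega),
      List.getElem?_append_left (by omega)]
    congr 1
    omega
  exact ⟨fun k hk => (key k hk.le).trans (h.1 k hk), (key t le_rfl).trans h.2⟩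

theorem isMark_replicate_append : IsMark z o t (List.replicate t z ++ [o]) 0 := by
  refine ⟨fun k hk => ?_, ?_⟩
  · rw [List.getElem?_append_left (by simpa using hk)]
    simp [hk]
  · simp

variable [Fintype α]

/-- All strings of length `m`. -/
def words (α : Type*) [Fintype α] (m : ℕ) : Finset (List α) :=
  (Finset.univ : Finset (Fin m → α)).map ⟨List.ofFn, List.ofFn_injective⟩

theorem mem_words {m : ℕ} {l : List α} : l ∈ words α m ↔ l.length = m := by
  simp only [words, Finset.mem_map, Finset.mem_univ, true_and, Function.Embedding.coeFn_mk]
  constructor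
  · rintro ⟨a, rfl⟩
    simp
  · rintro rfl
    exact ⟨l.get, List.ofFn_get l⟩

theorem card_words (m : ℕ) : (words α m).card = Fintype.card α ^ m := by
  simp [words]

open Classical in
/-- All strings of length at most `m`. -/
noncomputable def shortWords (α : Type*) [Fintype α] (m : ℕ) : Finset (List α) :=
  (Finset.range (m + 1)).biUnion (words α)

theorem mem_shortWords {m : ℕ} {l : List α} : l ∈ shortWords α m ↔ l.length ≤ m := by
  simp only [shortWords, Finset.mem_biUnion, mem_words, Finset.mem_range]
  constructor
  · rintro ⟨i, hi, rfl⟩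
    omega
  · exact fun h => ⟨_, by omega, rfl⟩

theorem exists_confusable_coloring (t L : ℕ) :
    ∃ χ : List α → ℕ, (∀ x, χ x < (2 * L + 1) ^ 2 * (shortWords α t).card + 1) ∧
      ∀ X Y : List α, X.length ≤ 2 * L → Y.length ≤ 2 * L → X ≠ Y → Confusable t X Y →
        χ X ≠ χ Y := by
  classical
  let nb : List α → Finset (List α) := fun Z =>
    ((Finset.range (Z.length + 1) ×ˢ Finset.range (Z.length + 1)) ×ˢ shortWords α t).image
      fun p => (Z.take p.1.1 ++ Z.drop (p.1.1 + p.2.length)).take p.1.2 ++ p.2 ++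
        (Z.take p.1.1 ++ Z.drop (p.1.1 + p.2.length)).drop p.1.2
  have hnb : ∀ X Y, Confusable t X Y → Y ∈ nb X := by
    rintro _ _ ⟨hl, _, ⟨u, v, w, rfl, rfl, hv⟩, ⟨u', v', w', rfl, e, hv'⟩⟩
    have hvv : v'.length = v.length := by
      have := congrArg List.length e
      simp only [List.length_append] at *
      omega
    refine Finset.mem_image.2 ⟨((u.length, u'.length), v'), ?_, ?_⟩
    · simp only [Finset.mem_product, Finset.mem_range, mem_shortWords]
      refine ⟨⟨?_, ?_⟩, hv'⟩ <;> simp only [List.length_append] at * <;> omega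
    · have e1 : (u ++ v ++ w).take u.length ++ (u ++ v ++ w).drop (u.length + v'.length) =
          u ++ w := by
        rw [hvv, ← List.length_append, List.drop_left, List.append_assoc, List.take_left]
      simp only [e1, e, List.take_left, List.drop_left]
  have hcard : ∀ X ∈ shortWords α (2 * L),
      (nb X).card ≤ (2 * L + 1) ^ 2 * (shortWords α t).card := by
    intro X hX
    rw [mem_shortWords] at hX
    refine Finset.card_image_le.trans ?_
    simp only [Finset.card_product, Finset.card_range, ← sq]
    gcongr
  obtain ⟨χ, h1, h2⟩ := exists_proper_coloring (Confusable t) (fun _ _ h => h.symm) _ nb hnb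
    (shortWords α (2 * L)) hcard
  exact ⟨χ, h1, fun X Y hX hY => h2 X (mem_shortWords.2 hX) Y (mem_shortWords.2 hY)⟩

open Classical in
/-- Strings of length `(t + 1) * K` without a mark. -/
noncomputable def unmarked (z o : α) (t K : ℕ) : Finset (List α) :=
  (words α ((t + 1) * K)).filter fun l => ∀ j, ¬ IsMark z o t l j

theorem card_unmarked_le (z o : α) (t K : ℕ) :
    (unmarked z o t K).card ≤ (Fintype.card α ^ (t + 1) - 1) ^ K := by
  classical
  induction K with
  | zero =>
    refine (Finset.card_filter_le _ _).trans ?_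
    simp [card_words]
  | succ K ih =>
    have hsub : unmarked z o t (K + 1) ⊆
        (((words α (t + 1)).erase (List.replicate t z ++ [o])) ×ˢ unmarked z o t K).image
          fun p => p.1 ++ p.2 := by
      intro l hl
      obtain ⟨h1, h2⟩ := Finset.mem_filter.1 hl
      rw [mem_words, mul_add, mul_one] at h1
      refine Finset.mem_image.2 ⟨(l.take (t + 1), l.drop (t + 1)), ?_, List.take_append_drop _ _⟩
      refine Finset.mem_product.2 ⟨Finset.mem_erase.2 ⟨fun h => ?_, ?_⟩, Finset.mem_filter.2
        ⟨?_, fun j hj => ?_⟩⟩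
      · have := (isMark_replicate_append (z := z) (o := o) (t := t)).append [] (l.drop (t + 1))
        dsimp only at h
        rw [← h, List.nil_append, List.take_append_drop] at this
        exact h2 _ this
      · rw [mem_words, List.length_take]; omega
      · rw [mem_words, List.length_drop]; omega
      · have := hj.append (l.take (t + 1)) []
        rw [List.append_nil, List.take_append_drop] at this
        exact h2 _ this
    refine (Finset.card_le_card hsub).trans (Finset.card_image_le.trans ?_)
    rw [Finset.card_product, Finset.card_erase_of_mem (by simp [mem_words]), card_words, pow_succ' (_ - 1)]
    exact Nat.mul_le_mul_left _ ih

open Classical in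
/-- The strings of length `N` in which the marks are dense. -/
noncomputable def denseWords (z o : α) (t δ N : ℕ) : Finset (List α) :=
  (words α N).filter (IsDense z o t δ)

theorem card_words_le_two_mul_card_denseWords (z o : α) (t K N : ℕ) (hK : 1 ≤ K)
    (h : 2 * N * (Fintype.card α ^ (t + 1) - 1) ^ K ≤ (Fintype.card α ^ (t + 1)) ^ K) :
    Fintype.card α ^ N ≤ 2 * (denseWords z o t ((t + 1) * K) N).card := by
  classical
  set q := Fintype.card α
  set δ := (t + 1) * K with hδ
  have hδpos : 0 < δ := by positivity
  have hq : 0 < q := Fintype.card_pos_iff.2 ⟨z⟩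
  have hsplit := Finset.card_filter_add_card_filter_not (s := words α N) (IsDense z o t δ)
  rw [card_words] at hsplit
  change _ = q ^ N at hsplit
  have hsub : (words α N).filter (fun x => ¬ IsDense z o t δ x) ⊆
      ((Finset.range N).filter fun p => p + δ ≤ N).biUnion fun p =>
        ((words α p ×ˢ unmarked z o t K) ×ˢ words α (N - p - δ)).image
          fun y => y.1.1 ++ y.1.2 ++ y.2 := by
    intro x hx
    obtain ⟨hx1, hx2⟩ := Finset.mem_filter.1 hx
    rw [mem_words] at hx1
    unfold IsDense at hx2
    push Not at hx2
    obtain ⟨p, hp, hno⟩ := hx2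
    rw [hx1] at hp
    refine Finset.mem_biUnion.2 ⟨p, by simp only [Finset.mem_filter, Finset.mem_range]; omega, ?_⟩
    have hx3 : x.take p ++ (x.drop p).take δ ++ x.drop (p + δ) = x := by
      rw [List.append_assoc, ← List.drop_drop, List.take_append_drop, List.take_append_drop]
    refine Finset.mem_image.2 ⟨((x.take p, (x.drop p).take δ), x.drop (p + δ)), ?_, hx3⟩
    simp only [Finset.mem_product, mem_words, unmarked, Finset.mem_filter, List.length_take,
      List.length_drop]
    refine ⟨⟨by omega, by omega, fun j hj => ?_⟩, by omega⟩
    have hjl : j + t < ((x.drop p).take δ).length := (List.getElem?_eq_some_iff.1 hj.2).1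
    have := hj.append (x.take p) (x.drop (p + δ))
    rw [hx3, List.length_take, min_eq_left (by omega)] at this
    rw [List.length_take] at hjl
    exact hno (p + j) (by omega) (by omega) this
  have hbad : ((words α N).filter (fun x => ¬ IsDense z o t δ x)).card * q ^ δ ≤
      N * ((q ^ (t + 1) - 1) ^ K * q ^ N) := by
    refine (Nat.mul_le_mul_right _ ((Finset.card_le_card hsub).trans
      Finset.card_biUnion_le)).trans ?_
    rw [Finset.sum_mul]
    refine (Finset.sum_le_card_nsmul _ _ ((q ^ (t + 1) - 1) ^ K * q ^ N) fun p hp => ?_).trans ?_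
    · simp only [Finset.mem_filter, Finset.mem_range] at hp
      refine (Nat.mul_le_mul_right _ Finset.card_image_le).trans ?_
      rw [Finset.card_product, Finset.card_product, card_words, card_words]
      calc q ^ p * (unmarked z o t K).card * q ^ (N - p - δ) * q ^ δ
          = (unmarked z o t K).card * (q ^ p * q ^ (N - p - δ) * q ^ δ) := by ring
        _ = (unmarked z o t K).card * q ^ N := by
          rw [← pow_add, ← pow_add]; congr 2; omega
        _ ≤ _ := Nat.mul_le_mul_right _ (card_unmarked_le z o t K)
    · rw [smul_eq_mul]
      refine Nat.mul_le_mul_right _ ((Finset.card_filter_le _ _).trans ?_)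
      simp
  have hbad2 : 2 * ((words α N).filter (fun x => ¬ IsDense z o t δ x)).card ≤ q ^ N := by
    refine Nat.le_of_mul_le_mul_right (c := q ^ δ) ?_ (by positivity)
    calc _ = 2 * (((words α N).filter (fun x => ¬ IsDense z o t δ x)).card * q ^ δ) := by ring
      _ ≤ 2 * (N * ((q ^ (t + 1) - 1) ^ K * q ^ N)) := Nat.mul_le_mul_left _ hbad
      _ = 2 * N * (q ^ (t + 1) - 1) ^ K * q ^ N := by ring
      _ ≤ (q ^ (t + 1)) ^ K * q ^ N := Nat.mul_le_mul_right _ h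
      _ = q ^ N * q ^ δ := by rw [hδ, pow_mul, mul_comm]
  unfold denseWords
  omega

/-! ### The code -/

theorem exists_code (hzo : z ≠ o) (K N A : ℕ) (hK : 1 ≤ K)
    (h : 2 * N * (Fintype.card α ^ (t + 1) - 1) ^ K ≤ (Fintype.card α ^ (t + 1)) ^ K)
    (L D : ℕ) (hL : L = 2 * t + (6 * t ^ 2 + 1) * ((t + 1) * K))
    (hD : D = (2 * L + 1) ^ 2 * (shortWords α t).card)
    (hA : 2 * ((6 * t + 1) * (9 * t ^ 2 * N + 1) * ((D + 1) * (D + 1))) * A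
      ≤ Fintype.card α ^ N) :
    ∃ S : Finset (List α), (∀ x ∈ S, x.length = N) ∧ A ≤ S.card ∧
      ∀ x ∈ S, ∀ y ∈ S, x ≠ y → ¬ Confusable t x y := by
  classical
  obtain ⟨χ, hχ, hproper⟩ := exists_confusable_coloring (α := α) t L
  rw [← hD] at hχ
  have hcard := card_words_le_two_mul_card_denseWords z o t K N hK h
  let F : List α → (ZMod (6 * t + 1) × ZMod (9 * t ^ 2 * N + 1)) × ZMod (D + 1) × ZMod (D + 1) :=
    fun x => ((((markCount z o t x : ℤ) : ZMod (6 * t + 1)),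
      ((markSum z o t x : ℤ) : ZMod (9 * t ^ 2 * N + 1))),
      ((syndrome χ L 0 x : ℕ) : ZMod (D + 1)), ((syndrome χ L 1 x : ℕ) : ZMod (D + 1)))
  obtain ⟨c, -, hc⟩ := Finset.exists_le_card_fiber_of_mul_le_card_of_maps_to
    (s := denseWords z o t ((t + 1) * K) N) (t := Finset.univ) (f := F) (n := A)
    (fun _ _ => Finset.mem_univ _) ⟨0, Finset.mem_univ _⟩ (by
      simp only [Finset.card_univ, Fintype.card_prod, ZMod.card]
      nlinarith)
  have hshift : ∀ u v v' m w : List α, v.length = v'.length → v.length ≤ t →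
      (u ++ v ++ m ++ w).length = N →
      IsDense z o t ((t + 1) * K) (u ++ v ++ m ++ w) →
      F (u ++ v ++ m ++ w) = F (u ++ m ++ v' ++ w) → u ++ v ++ m ++ w = u ++ m ++ v' ++ w := by
    intro u v v' m w hv hvt hN hd hF
    rcases Nat.eq_zero_or_pos v.length with h0 | hpos
    · rw [List.length_eq_zero_iff.1 h0, List.length_eq_zero_iff.1 (hv.symm.trans h0)]
      simp
    simp only [F, Prod.mk.injEq, ZMod.intCast_eq_intCast_iff, ZMod.natCast_eq_natCast_iff] at hF
    obtain ⟨⟨h1, h2⟩, h3, h4⟩ := hF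
    rw [← hN] at h2
    have hm := length_lt_of_shift hzo t _ u v v' m w hv hpos hvt hd h1 h2
    refine eq_of_syndrome_eq t L D χ hχ (by omega) hproper u v v' m w hv hvt (by omega) ?_
    intro b hb
    interval_cases b
    · exact h3
    · exact h4
  refine ⟨_, fun x hx => ?_, hc, fun x hx y hy hxy hconf => hxy ?_⟩
  · exact mem_words.1 (Finset.mem_filter.1 (Finset.mem_filter.1 hx).1).1
  · obtain ⟨hx1, hx2⟩ := Finset.mem_filter.1 hx
    obtain ⟨hy1, hy2⟩ := Finset.mem_filter.1 hy
    obtain ⟨hx3, hx4⟩ := Finset.mem_filter.1 hx1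
    obtain ⟨hy3, hy4⟩ := Finset.mem_filter.1 hy1
    rw [mem_words] at hx3 hy3
    obtain ⟨u, v, v', m, w, hv, hvt, ⟨rfl, rfl⟩ | ⟨rfl, rfl⟩⟩ := hconf.exists_shift
    · exact hshift u v v' m w hv hvt hx3 hx4 (hx2.trans hy2.symm)
    · exact (hshift u v v' m w hv hvt hy3 hy4 (hy2.trans hx2.symm)).symm

end Counting

/-! ### Choice of parameters -/

theorem eventually_four_mul_pow_le (Q : ℕ) (hQ : 1 ≤ Q) :
    ∀ᶠ l : ℕ in Filter.atTop, 4 * (Q - 1) ^ l ≤ Q ^ l := by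
  have hQ' : (0 : ℝ) < Q := by exact_mod_cast hQ
  have hlim := tendsto_pow_atTop_nhds_zero_of_lt_one (r := ((Q - 1 : ℕ) : ℝ) / Q) (by positivity)
    (by rw [div_lt_one hQ']; exact_mod_cast Nat.sub_lt hQ one_pos)
  filter_upwards [hlim.eventually_le_const (show (0 : ℝ) < 1 / 4 by norm_num)] with l hl
  rw [div_pow, div_le_iff₀ (by positivity)] at hl
  have : (4 : ℝ) * ((Q - 1 : ℕ) : ℝ) ^ l ≤ (Q : ℝ) ^ l := by linarith
  exact_mod_cast this

theorem eventually_pow_le_two_pow (k : ℕ) : ∀ᶠ n : ℕ in Filter.atTop, n ^ k ≤ 2 ^ n := by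
  have := (isLittleO_pow_const_const_pow_of_one_lt (R := ℝ) k (r := 2) (by norm_num)).bound
    one_pos
  filter_upwards [this] with n hn
  rw [one_mul, Real.norm_of_nonneg (by positivity), Real.norm_of_nonneg (by positivity)] at hn
  exact_mod_cast hn

/-- The number of syndrome classes is `O(n l⁸)` when the density parameter is `l²`. -/
theorem exists_class_bound (t W : ℕ) : ∃ c : ℕ, ∀ n l N L D : ℕ, 1 ≤ n → 1 ≤ l → N ≤ 2 * n →
    L = 2 * t + (6 * t ^ 2 + 1) * ((t + 1) * l ^ 2) → D = (2 * L + 1) ^ 2 * W →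
    2 * ((6 * t + 1) * (9 * t ^ 2 * N + 1) * ((D + 1) * (D + 1))) ≤ c * (n * l ^ 8) := by
  set c₁ := 2 * t + (6 * t ^ 2 + 1) * (t + 1) with hc₁
  set c₂ := (2 * c₁ + 1) ^ 2 * W + 1 with hc₂
  refine ⟨2 * ((6 * t + 1) * (18 * t ^ 2 + 1) * (c₂ * c₂)), fun n l N L D hn hl hN hL hD => ?_⟩
  have hl2 : 1 ≤ l ^ 2 := Nat.one_le_pow _ _ hl
  have hl4 : 1 ≤ l ^ 4 := Nat.one_le_pow _ _ hl
  have h1 : 2 * L + 1 ≤ (2 * c₁ + 1) * l ^ 2 := by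
    have : 2 * t * 1 ≤ 2 * t * l ^ 2 := Nat.mul_le_mul_left _ hl2
    rw [hL, hc₁]
    linarith
  have h2 : D + 1 ≤ c₂ * l ^ 4 := by
    have : (2 * L + 1) ^ 2 * W ≤ ((2 * c₁ + 1) * l ^ 2) ^ 2 * W := by gcongr
    rw [hD, hc₂]
    linarith
  have h3 : 9 * t ^ 2 * N + 1 ≤ (18 * t ^ 2 + 1) * n := by
    have : 9 * t ^ 2 * N ≤ 9 * t ^ 2 * (2 * n) := Nat.mul_le_mul_left _ hN
    linarith
  calc 2 * ((6 * t + 1) * (9 * t ^ 2 * N + 1) * ((D + 1) * (D + 1)))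
      ≤ 2 * ((6 * t + 1) * ((18 * t ^ 2 + 1) * n) * ((c₂ * l ^ 4) * (c₂ * l ^ 4))) := by gcongr
    _ = _ := by ring

theorem two_mul_mul_pow_le {Q l N : ℕ} (hl : 3 ≤ l) (h : 4 * (Q - 1) ^ l ≤ Q ^ l)
    (hN : N ≤ 2 ^ (l + 2)) : 2 * N * (Q - 1) ^ l ^ 2 ≤ Q ^ l ^ 2 := by
  have hN' : 2 * N ≤ 4 ^ l := by
    calc 2 * N ≤ 2 * 2 ^ (l + 2) := Nat.mul_le_mul_left _ hN
      _ = 2 ^ (l + 3) := by ring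
      _ ≤ 2 ^ (2 * l) := Nat.pow_le_pow_right two_pos (by omega)
      _ = 4 ^ l := by rw [pow_mul]; norm_num
  calc 2 * N * (Q - 1) ^ l ^ 2 ≤ 4 ^ l * (Q - 1) ^ l ^ 2 := Nat.mul_le_mul_right _ hN'
    _ = (4 * (Q - 1) ^ l) ^ l := by rw [mul_pow, ← pow_mul, sq]
    _ ≤ (Q ^ l) ^ l := Nat.pow_le_pow_left h l
    _ = Q ^ l ^ 2 := by rw [← pow_mul, sq]

theorem clog_mul_logb_le {q n : ℕ} (hq : 2 ≤ q) (hl : 2 ≤ Nat.log 2 n) (k : ℕ) (hk : k ≠ 0) :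
    (Nat.clog q (n * Nat.log 2 n ^ k) : ℝ) * Real.logb 2 q ≤
      Real.logb 2 n + k * Real.logb 2 (Real.logb 2 n) + Real.logb 2 q := by
  have hn : 1 ≤ n := Nat.one_le_iff_ne_zero.2 (by rintro rfl; simp at hl)
  have hx : 1 < n * Nat.log 2 n ^ k :=
    lt_of_lt_of_le (Nat.one_lt_pow hk hl) (Nat.le_mul_of_pos_left _ hn)
  have hr : 0 < Nat.clog q (n * Nat.log 2 n ^ k) := Nat.clog_pos hq hx
  have hlt := Nat.pow_pred_clog_lt_self hq hx
  obtain ⟨r, hr'⟩ := Nat.exists_eq_succ_of_ne_zero hr.ne'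
  rw [hr', Nat.pred_succ] at hlt
  rw [hr']
  have hn' : (0 : ℝ) < n := by exact_mod_cast hn
  have hl' : (0 : ℝ) < Nat.log 2 n := by exact_mod_cast (by omega : 0 < Nat.log 2 n)
  have hq' : (0 : ℝ) < q := by exact_mod_cast (by omega : 0 < q)
  have h1 : Real.logb 2 ((q : ℝ) ^ r) ≤ Real.logb 2 (n * (Nat.log 2 n : ℝ) ^ k) :=
    Real.logb_le_logb_of_le one_lt_two (by positivity) (by exact_mod_cast hlt.le)
  rw [Real.logb_pow, Real.logb_mul hn'.ne' (by positivity), Real.logb_pow] at h1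
  have h2 : Real.logb 2 (Nat.log 2 n : ℝ) ≤ Real.logb 2 (Real.logb 2 n) :=
    Real.logb_le_logb_of_le one_lt_two hl' (by exact_mod_cast Real.natLog_le_logb n 2)
  have h3 : (k : ℝ) * Real.logb 2 (Nat.log 2 n : ℝ) ≤ k * Real.logb 2 (Real.logb 2 n) := by gcongr
  push_cast
  linarith

end BurstCode

open BurstCode in
theorem stmt_5 (q t : ℕ) (hq : 2 ≤ q) (hqeven : Even q) (ht : 1 ≤ t)
    (ε : ℝ) (hε : 0 < ε) :
    ∃ γ : ℝ, ∃ n₀ : ℕ, ∀ n : ℕ, n₀ ≤ n →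
      ∃ N : ℕ,
        ∃ E : {u : List (Fin q) // u.length = n - 1} → {v : List (Fin q) // v.length = N},
          Function.Injective E ∧
          ((N : ℝ) - ((n : ℝ) - 1)) * Real.logb 2 q ≤
            Real.logb 2 n + (8 * Real.logb 2 q + 9 + ε) * Real.logb 2 (Real.logb 2 n) + γ ∧
          ∀ u u' : {u : List (Fin q) // u.length = n - 1}, u ≠ u' →
            Bset t (E u).val ∩ Bset t (E u').val = ∅ := by
  obtain ⟨c, hc⟩ := exists_class_bound t (shortWords (Fin q) t).card
  obtain ⟨l₁, hl₁⟩ := Filter.eventually_atTop.1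
    (eventually_four_mul_pow_le (q ^ (t + 1)) (Nat.one_le_pow _ _ (by omega)))
  obtain ⟨n₁, hn₁⟩ := Filter.eventually_atTop.1 (eventually_pow_le_two_pow 10)
  refine ⟨Real.logb 2 q, max n₁ (2 ^ (max l₁ (max c 3))), fun n hn => ?_⟩
  obtain ⟨hnn₁, hn2⟩ := max_le_iff.1 hn
  have hn1 : 1 ≤ n := (Nat.one_le_two_pow).trans hn2
  have hl : max l₁ (max c 3) ≤ Nat.log 2 n := Nat.le_log_of_pow_le one_lt_two hn2
  have hred := clog_mul_logb_le (n := n) hq (by omega) 9 (by norm_num)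
  have hrn : Nat.clog q (n * Nat.log 2 n ^ 9) ≤ n := by
    refine (Nat.clog_le_iff_le_pow hq).2 ?_
    calc n * Nat.log 2 n ^ 9 ≤ n * n ^ 9 := by gcongr; exact Nat.log_le_self 2 n
      _ = n ^ 10 := by ring
      _ ≤ 2 ^ n := hn₁ n hnn₁
      _ ≤ q ^ n := Nat.pow_le_pow_left hq n
  have hrpow := Nat.le_pow_clog hq (n * Nat.log 2 n ^ 9)
  have hnlt : n < 2 ^ (Nat.log 2 n + 1) := Nat.lt_pow_succ_log_self one_lt_two n
  have hlog : 1 ≤ Real.logb 2 n := by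
    rw [Real.le_logb_iff_rpow_le one_lt_two (by exact_mod_cast hn1), Real.rpow_one]
    have : 2 ^ 1 ≤ 2 ^ (max l₁ (max c 3)) := Nat.pow_le_pow_right two_pos (by omega)
    exact_mod_cast this.trans hn2
  generalize Nat.clog q (n * Nat.log 2 n ^ 9) = r at *
  generalize Nat.log 2 n = l at *
  obtain ⟨S, hS1, hS2, hS3⟩ := exists_code (α := Fin q) (t := t)
    (z := ⟨0, by omega⟩) (o := ⟨1, by omega⟩) (by simp) (l ^ 2) (n - 1 + r) (q ^ (n - 1))
    (Nat.one_le_pow _ _ (by omega))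
    (by
      rw [Fintype.card_fin]
      refine two_mul_mul_pow_le (by omega) (hl₁ l (by omega)) ?_
      rw [pow_succ] at hnlt ⊢
      omega) _ _ rfl rfl (by
      rw [Fintype.card_fin]
      calc _ ≤ c * (n * l ^ 8) * q ^ (n - 1) :=
            Nat.mul_le_mul_right _ (hc n l _ _ _ hn1 (by omega) (by omega) rfl rfl)
        _ ≤ l * (n * l ^ 8) * q ^ (n - 1) := by gcongr; omega
        _ = n * l ^ 9 * q ^ (n - 1) := by ring
        _ ≤ q ^ r * q ^ (n - 1) := Nat.mul_le_mul_right _ hrpow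
        _ = q ^ (n - 1 + r) := by ring)
  obtain ⟨f⟩ : Nonempty (words (Fin q) (n - 1) ↪ S) :=
    Function.Embedding.nonempty_of_card_le (by
      rwa [Fintype.card_coe, Fintype.card_coe, card_words, Fintype.card_fin])
  let E : {u : List (Fin q) // u.length = n - 1} → {v : List (Fin q) // v.length = n - 1 + r} :=
    fun u => ⟨(f ⟨u.1, mem_words.2 u.2⟩).1, hS1 _ (f ⟨u.1, mem_words.2 u.2⟩).2⟩
  have hE : Function.Injective E := by
    intro u u' h
    have hval : (E u).1 = (E u').1 := congrArg Subtype.val h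
    have hsub := congrArg Subtype.val (f.injective (Subtype.ext hval))
    exact Subtype.ext hsub
  refine ⟨n - 1 + r, E, hE, ?_, fun u u' huu => ?_⟩
  · have hloglog : 0 ≤ Real.logb 2 (Real.logb 2 n) := Real.logb_nonneg one_lt_two hlog
    have hlq : 0 ≤ Real.logb 2 q := Real.logb_nonneg one_lt_two (by exact_mod_cast (by omega))
    have : 0 ≤ (8 * Real.logb 2 q + ε) * Real.logb 2 (Real.logb 2 n) := by positivity
    push_cast [Nat.cast_sub hn1] at hred ⊢
    linarith
  · rw [Set.eq_empty_iff_forall_notMem]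
    rintro y ⟨hy, hy'⟩
    exact hS3 _ (f _).2 _ (f _).2 (fun h => huu (hE (Subtype.ext h)))
      ⟨(E u).2.trans (E u').2.symm, y, hy, hy'⟩
end
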